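/- arXiv:2501.04887 — 3 statements merged into one kernel-verified Lean document; each statement's English description precedes it below -/
import Mathlib

section
/- There exists a constant C > 0 depending only on P and Q such that for every admissible prime p, the number of F_p-points of the Roth variety for corners associated to P, Q satisfies |Y(F_p)| ≤ C · p^6. -/
open scoped BigOperators ComplexOrder
open Polynomial

noncomputable section

namespace RatCorners

/-- Reduction of a rational number modulo `p` (genuine when `p` does not divide the
denominator). -/
def ratRed (p : ℕ) (q : ℚ) : ZMod p := (q.num : ZMod p) * (q.den : ZMod p)⁻¹

/-- Coefficientwise reduction of a polynomial with rational coefficients modulo `p`. -/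
def polyRed (p : ℕ) (f : Polynomial ℚ) : Polynomial (ZMod p) :=
  f.sum fun n a => Polynomial.C (ratRed p a) * Polynomial.X ^ n

/-- `p` divides no denominator of any coefficient of `P` (with numerator and denominator
of `P` in lowest terms). -/
def Admissible (p : ℕ) (P : RatFunc ℚ) : Prop :=
  (∀ n, ¬ p ∣ (P.num.coeff n).den) ∧ ∀ n, ¬ p ∣ (P.denom.coeff n).den

/-- `y` is a pole of the reduction of `P` modulo `p`. -/
def IsPole (p : ℕ) (P : RatFunc ℚ) (y : ZMod p) : Prop :=
  (polyRed p P.denom).eval y = 0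

instance (p : ℕ) (P : RatFunc ℚ) : DecidablePred (IsPole p P) := fun y =>
  inferInstanceAs (Decidable ((polyRed p P.denom).eval y = 0))

/-- Evaluation of the reduction of `P` modulo `p` at `y` (junk value `0` at poles). -/
def evalRed (p : ℕ) (P : RatFunc ℚ) (y : ZMod p) : ZMod p :=
  (polyRed p P.num).eval y * ((polyRed p P.denom).eval y)⁻¹

/-- A function is `1`-bounded if all its values have norm at most `1`. -/
def OneBounded {α : Type*} (f : α → ℂ) : Prop := ∀ x, ‖f x‖ ≤ 1

/-- The formal derivative of a rational function. -/
def ratDeriv (P : RatFunc ℚ) : RatFunc ℚ :=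
  algebraMap (Polynomial ℚ) (RatFunc ℚ)
      (Polynomial.derivative P.num * P.denom - P.num * Polynomial.derivative P.denom) /
    algebraMap (Polynomial ℚ) (RatFunc ℚ) (P.denom ^ 2)

/-- Substitution of the variable `y i` into a rational function `P ∈ ℚ(t)`, producing an
element of the rational function field `ℚ(y 0, …, y (n-1))`. -/
def substAt {n : ℕ} (P : RatFunc ℚ) (i : Fin n) : FractionRing (MvPolynomial (Fin n) ℚ) :=
  Polynomial.eval₂
      ((algebraMap (MvPolynomial (Fin n) ℚ) (FractionRing (MvPolynomial (Fin n) ℚ))).comp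
        MvPolynomial.C)
      (algebraMap (MvPolynomial (Fin n) ℚ) (FractionRing (MvPolynomial (Fin n) ℚ))
        (MvPolynomial.X i)) P.num /
    Polynomial.eval₂
      ((algebraMap (MvPolynomial (Fin n) ℚ) (FractionRing (MvPolynomial (Fin n) ℚ))).comp
        MvPolynomial.C)
      (algebraMap (MvPolynomial (Fin n) ℚ) (FractionRing (MvPolynomial (Fin n) ℚ))
        (MvPolynomial.X i)) P.denom

variable (p : ℕ) [NeZero p]

/-- The counting operator `𝔼_{x₁,x₂,y} f₀(x₁,x₂) f₁(x₁+P(y),x₂) f₂(x₁,x₂+Q(y))`,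
where the average in `y` avoids the poles of `P` and `Q` but is still normalized by `1/p`. -/
def cornerAvg (P Q : RatFunc ℚ) (f0 f1 f2 : ZMod p × ZMod p → ℂ) : ℂ :=
  (p : ℂ)⁻¹ ^ 3 * ∑ x1 : ZMod p, ∑ x2 : ZMod p, ∑ y : ZMod p,
    if ¬ IsPole p P y ∧ ¬ IsPole p Q y then
      f0 (x1, x2) * f1 (x1 + evalRed p P y, x2) * f2 (x1, x2 + evalRed p Q y)
    else 0

/-- The main term `𝔼_{x₁,x₂} f₀(x₁,x₂) · 𝔼_a f₁(a,x₂) · 𝔼_b f₂(x₁,b)`. -/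
def mainTerm (f0 f1 f2 : ZMod p × ZMod p → ℂ) : ℂ :=
  (p : ℂ)⁻¹ ^ 2 * ∑ x1 : ZMod p, ∑ x2 : ZMod p,
    f0 (x1, x2) * ((p : ℂ)⁻¹ * ∑ a : ZMod p, f1 (a, x2)) *
      ((p : ℂ)⁻¹ * ∑ b : ZMod p, f2 (x1, b))

/-- The `L^r` norm with respect to the uniform probability measure on `(ZMod p)²`. -/
def Lnorm (r : ℝ) (f : ZMod p × ZMod p → ℂ) : ℝ :=
  ((p : ℝ)⁻¹ ^ 2 * ∑ x : ZMod p × ZMod p, ‖f x‖ ^ r) ^ r⁻¹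

/-- The Gowers norm `‖f‖_{U²(0×F_p)}` along the second coordinate axis. -/
def U2vert (f : ZMod p × ZMod p → ℂ) : ℝ :=
  ((p : ℝ)⁻¹ ^ 4 * (∑ x : ZMod p × ZMod p, ∑ h : ZMod p, ∑ k : ZMod p,
      f x * (starRingEnd ℂ) (f (x + (0, h))) * (starRingEnd ℂ) (f (x + (0, k))) *
        f (x + (0, h + k))).re) ^ ((4:ℝ)⁻¹)

/-- The Gowers norm `‖f‖_{U²(F_p×0)}` along the first coordinate axis. -/
def U2horiz (f : ZMod p × ZMod p → ℂ) : ℝ :=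
  ((p : ℝ)⁻¹ ^ 4 * (∑ x : ZMod p × ZMod p, ∑ h : ZMod p, ∑ k : ZMod p,
      f x * (starRingEnd ℂ) (f (x + (h, 0))) * (starRingEnd ℂ) (f (x + (k, 0))) *
        f (x + (h + k, 0))).re) ^ ((4:ℝ)⁻¹)

/-- The additive character `e_p(x) = e^{2πix/p}` on `ZMod p`. -/
def ep (x : ZMod p) : ℂ := Complex.exp (2 * Real.pi * Complex.I * (x.val : ℂ) / (p : ℂ))

/-- `e(r) = e^{2πir}` for a real number `r`. -/
def eC (r : ℝ) : ℂ := Complex.exp (2 * Real.pi * Complex.I * (r : ℂ))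

/-- The Fourier transform `f̂(ξ) = 𝔼_x f(x) e_p(−x·ξ)` on `(ZMod p)²`. -/
def dft (f : ZMod p × ZMod p → ℂ) (ξ : ZMod p × ZMod p) : ℂ :=
  (p : ℂ)⁻¹ ^ 2 * ∑ x : ZMod p × ZMod p, f x * ep p (-(x.1 * ξ.1 + x.2 * ξ.2))

/-- `F₁(n₁,𝐡) = ∑_{n₂} Δ_{−𝐡} f̂₁(n₁,n₂)` where `Δ_h g(x) = g(x)·conj g(x+h)`. -/
def F1 (f : ZMod p × ZMod p → ℂ) (n1 : ZMod p) (h : ZMod p × ZMod p) : ℂ :=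
  ∑ n2 : ZMod p, dft p f (n1, n2) * (starRingEnd ℂ) (dft p f ((n1, n2) + -h))

/-- `F₂(m₂,𝐡) = ∑_{m₁} Δ_{𝐡} f̂₂(m₁,m₂)` where `Δ_h g(x) = g(x)·conj g(x+h)`. -/
def F2 (f : ZMod p × ZMod p → ℂ) (m2 : ZMod p) (h : ZMod p × ZMod p) : ℂ :=
  ∑ m1 : ZMod p, dft p f (m1, m2) * (starRingEnd ℂ) (dft p f ((m1, m2) + h))

/-- The `F_p`-points of the Roth variety for corners associated to `P, Q`:
tuples `(y₁,…,y₁₆)` (indexed here by `0,…,15`) avoiding all poles of `P` and `Q` and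
satisfying the ten defining equations. -/
def IsRothPoint (P Q : RatFunc ℚ) (y : Fin 16 → ZMod p) : Prop :=
  (∀ i, ¬ IsPole p P (y i)) ∧ (∀ i, ¬ IsPole p Q (y i)) ∧
  evalRed p P (y 0) - evalRed p P (y 2) - evalRed p P (y 8) + evalRed p P (y 10) = 0 ∧
  evalRed p P (y 1) - evalRed p P (y 3) - evalRed p P (y 9) + evalRed p P (y 11) = 0 ∧
  evalRed p P (y 4) - evalRed p P (y 6) - evalRed p P (y 12) + evalRed p P (y 14) = 0 ∧
  evalRed p P (y 5) - evalRed p P (y 7) - evalRed p P (y 13) + evalRed p P (y 15) = 0 ∧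
  evalRed p Q (y 0) - evalRed p Q (y 1) - evalRed p Q (y 8) + evalRed p Q (y 9) = 0 ∧
  evalRed p Q (y 2) - evalRed p Q (y 6) - evalRed p Q (y 10) + evalRed p Q (y 14) = 0 ∧
  evalRed p Q (y 3) - evalRed p Q (y 7) - evalRed p Q (y 11) + evalRed p Q (y 15) = 0 ∧
  evalRed p Q (y 4) - evalRed p Q (y 5) - evalRed p Q (y 12) + evalRed p Q (y 13) = 0 ∧
  evalRed p P (y 8) - evalRed p P (y 9) - evalRed p P (y 10) + evalRed p P (y 11) -
      evalRed p P (y 12) + evalRed p P (y 13) + evalRed p P (y 14) - evalRed p P (y 15) = 0 ∧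
  evalRed p Q (y 8) - evalRed p Q (y 9) - evalRed p Q (y 10) + evalRed p Q (y 11) -
      evalRed p Q (y 12) + evalRed p Q (y 13) + evalRed p Q (y 14) - evalRed p Q (y 15) = 0

/-- `|Y(F_p)|`, the number of `F_p`-points of the Roth variety for corners. -/
def rothCard (P Q : RatFunc ℚ) : ℕ :=
  Nat.card {y : Fin 16 → ZMod p // IsRothPoint p P Q y}

/-- `χ` is an eigenfunction with respect to the first coordinate:
`χ(x₁,x₂) = 1_E(x₂) e_p(φ(x₂)x₁) e(ψ(x₂))`. -/
def IsEigen1 (χ : ZMod p × ZMod p → ℂ) : Prop :=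
  ∃ (E : Finset (ZMod p)) (φ : ZMod p → ZMod p) (ψ : ZMod p → ℝ),
    ∀ x1 x2 : ZMod p,
      χ (x1, x2) = (if x2 ∈ E then 1 else 0) * ep p (φ x2 * x1) * eC (ψ x2)

/-- `χ` is an eigenfunction with respect to the second coordinate:
`χ(x₁,x₂) = 1_E(x₁) e_p(φ(x₁)x₂) e(ψ(x₁))`. -/
def IsEigen2 (χ : ZMod p × ZMod p → ℂ) : Prop :=
  ∃ (E : Finset (ZMod p)) (φ : ZMod p → ZMod p) (ψ : ZMod p → ℝ),
    ∀ x1 x2 : ZMod p,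
      χ (x1, x2) = (if x1 ∈ E then 1 else 0) * ep p (φ x1 * x2) * eC (ψ x1)

/-- The two-term counting operator `𝔼_{x₁,x₂,y} f₀(x₁,x₂) f₁(x₁+P(y),x₂)`. -/
def twoAvg1 (P : RatFunc ℚ) (f0 f1 : ZMod p × ZMod p → ℂ) : ℂ :=
  (p : ℂ)⁻¹ ^ 3 * ∑ x1 : ZMod p, ∑ x2 : ZMod p, ∑ y : ZMod p,
    if ¬ IsPole p P y then f0 (x1, x2) * f1 (x1 + evalRed p P y, x2) else 0

/-- The two-term counting operator `𝔼_{x₁,x₂,y} f₀(x₁,x₂) f₁(x₁,x₂+P(y))`. -/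
def twoAvg2 (P : RatFunc ℚ) (f0 f1 : ZMod p × ZMod p → ℂ) : ℂ :=
  (p : ℂ)⁻¹ ^ 3 * ∑ x1 : ZMod p, ∑ x2 : ZMod p, ∑ y : ZMod p,
    if ¬ IsPole p P y then f0 (x1, x2) * f1 (x1, x2 + evalRed p P y) else 0

/-- The coordinates indexed by `e` satisfy a nontrivial polynomial relation of degree at most `D`
on the set `X`. -/
def CoordDependent {F σ : Type} [Field F] (D : ℕ) (X : Finset (σ → F)) {m : ℕ}
    (e : Fin m → σ) : Prop :=
  ∃ f : MvPolynomial (Fin m) F, f ≠ 0 ∧ f.totalDegree ≤ D ∧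
    ∀ x ∈ X, MvPolynomial.eval (x ∘ e) f = 0

theorem CoordDependent.mono {F σ : Type} [Field F] {D : ℕ} {X Y : Finset (σ → F)} {m : ℕ}
    {e : Fin m → σ} (h : CoordDependent D X e) (hY : Y ⊆ X) : CoordDependent D Y e := by
  obtain ⟨f, h0, h1, h2⟩ := h
  exact ⟨f, h0, h1, fun x hx => h2 x (hY hx)⟩

theorem exists_coord_bound {F σ : Type} [Field F] [DecidableEq F] {D d : ℕ}
    {X : Finset (σ → F)} {e : Fin d → σ} {j : σ}
    (h : j ∉ Set.range e → CoordDependent D X (Fin.cons j e : Fin (d + 1) → σ)) :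
    ∃ c : MvPolynomial (Fin d) F, c ≠ 0 ∧ c.totalDegree ≤ D ∧
      ∃ S : (Fin d → F) → Finset F, (∀ s, (S s).card ≤ D + 1) ∧
        ∀ x ∈ X, MvPolynomial.eval (x ∘ e) c ≠ 0 → x j ∈ S (x ∘ e) := by
  by_cases hj : j ∈ Set.range e
  · obtain ⟨i, rfl⟩ := hj
    exact ⟨1, one_ne_zero, by simp, fun s => {s i}, by simp, by simp⟩
  · obtain ⟨f, hf0, hfD, hfX⟩ := h hj
    set g := MvPolynomial.finSuccEquiv F d f with hg
    have hg0 : g ≠ 0 := by simpa [hg] using hf0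
    have hgD : g.natDegree ≤ D := by
      rw [hg, MvPolynomial.natDegree_finSuccEquiv]
      exact (MvPolynomial.degreeOf_le_totalDegree f 0).trans hfD
    refine ⟨g.leadingCoeff, by simpa using hg0, ?_,
      fun s => (g.map (MvPolynomial.eval s)).roots.toFinset, fun s => ?_, fun x hx hc => ?_⟩
    · have := MvPolynomial.totalDegree_coeff_finSuccEquiv_add_le f g.natDegree
        (by rw [← hg]; exact Polynomial.leadingCoeff_ne_zero.mpr hg0)
      exact le_trans (le_trans (Nat.le_add_right _ _) this) hfD
    · refine (Multiset.toFinset_card_le _).trans ((Polynomial.card_roots' _).trans ?_)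
      exact (Polynomial.natDegree_map_le.trans hgD).trans (Nat.le_succ _)
    · have h0 : g.map (MvPolynomial.eval (x ∘ e)) ≠ 0 := by
        intro h0
        apply hc
        have := congrArg (fun q => Polynomial.coeff q g.natDegree) h0
        simpa using this
      rw [Multiset.mem_toFinset, Polynomial.mem_roots h0, Polynomial.IsRoot, hg,
        ← MvPolynomial.eval_eq_eval_mv_eval']
      have := hfX x hx
      rwa [← Matrix.vecCons, show x ∘ (Matrix.vecCons j e) = Fin.cons (x j) (x ∘ e) from by
        funext i; refine Fin.cases ?_ (fun i => ?_) i <;> simp] at this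

theorem exists_card_le_aux (σ : Type) [Fintype σ] (D d : ℕ)
    (hbase : ∃ C : ℕ, ∀ (F : Type) [Field F] [Fintype F] (X : Finset (σ → F)),
      (∀ e : Fin d → σ, Function.Injective e → CoordDependent D X e) →
      X.card ≤ C * Fintype.card F ^ d) :
    ∃ C : ℕ, ∀ (F : Type) [Field F] [Fintype F] (X : Finset (σ → F)),
      (∀ e : Fin (d + 1) → σ, Function.Injective e → CoordDependent D X e) →
      X.card ≤ C * Fintype.card F ^ d := by
  classical
  suffices H : ∀ m : ℕ, ∃ C : ℕ, ∀ (F : Type) [Field F] [Fintype F] (X : Finset (σ → F)),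
      (∀ e : Fin (d + 1) → σ, Function.Injective e → CoordDependent D X e) →
      (Finset.univ.filter fun e : Fin d → σ =>
        Function.Injective e ∧ ¬ CoordDependent D X e).card ≤ m →
      X.card ≤ C * Fintype.card F ^ d by
    obtain ⟨C, hC⟩ := H (Fintype.card (Fin d → σ))
    exact ⟨C, fun F _ _ X h => hC F X h (Finset.card_le_univ _)⟩
  obtain ⟨C₀, hC₀⟩ := hbase
  intro m
  induction m with
  | zero =>
    refine ⟨C₀, fun F _ _ X _ hm => hC₀ F X fun e he => ?_⟩
    by_contra hdep
    have : e ∈ (Finset.univ.filter fun e : Fin d → σ =>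
        Function.Injective e ∧ ¬ CoordDependent D X e) := by simp [he, hdep]
    rw [Finset.card_eq_zero.mp (Nat.le_zero.mp hm)] at this
    simp at this
  | succ m ih =>
    obtain ⟨C₁, hC₁⟩ := ih
    refine ⟨C₀ + ((D + 1) ^ Fintype.card σ + Fintype.card σ * C₁), fun F _ _ X hX hm => ?_⟩
    by_cases hall : ∀ e : Fin d → σ, Function.Injective e → CoordDependent D X e
    · exact (hC₀ F X hall).trans (Nat.mul_le_mul_right _ (Nat.le_add_right _ _))
    push Not at hall
    obtain ⟨e, he, hdep⟩ := hall
    have key : ∀ j : σ, _ := fun j => exists_coord_bound (X := X) (D := D) (e := e) (j := j)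
      (fun hj => hX _ (Fin.cons_injective_iff.mpr ⟨hj, he⟩))
    choose c hc0 hcD S hS hXS using key
    have hsub : X ⊆ (X.filter fun x => ∀ j, MvPolynomial.eval (x ∘ e) (c j) ≠ 0) ∪
        Finset.univ.biUnion fun j => X.filter fun x => MvPolynomial.eval (x ∘ e) (c j) = 0 := by
      intro x hx
      by_cases h : ∀ j, MvPolynomial.eval (x ∘ e) (c j) ≠ 0
      · simp [hx, h]
      · push Not at h
        obtain ⟨j, hj⟩ := h
        exact Finset.mem_union_right _ (Finset.mem_biUnion.mpr
          ⟨j, Finset.mem_univ _, Finset.mem_filter.mpr ⟨hx, hj⟩⟩)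
    have h1 : (X.filter fun x => ∀ j, MvPolynomial.eval (x ∘ e) (c j) ≠ 0).card ≤
        (D + 1) ^ Fintype.card σ * Fintype.card F ^ d := by
      refine (Finset.card_le_mul_card_image (f := fun x : σ → F => x ∘ e) _
        ((D + 1) ^ Fintype.card σ) fun s _ => ?_).trans
        (Nat.mul_le_mul_left _ ((Finset.card_le_univ _).trans (by simp)))
      refine (Finset.card_le_card (t := Fintype.piFinset fun j => S j s) ?_).trans ?_
      · intro x hx
        simp only [Finset.mem_filter] at hx
        obtain ⟨⟨hxX, hxc⟩, rfl⟩ := hx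
        exact Fintype.mem_piFinset.mpr fun j => hXS j x hxX (hxc j)
      · rw [Fintype.card_piFinset]
        exact (Finset.prod_le_pow_card _ _ _ fun j _ => hS j s).trans (by simp)
    have h2 : ∀ j, (X.filter fun x => MvPolynomial.eval (x ∘ e) (c j) = 0).card ≤
        C₁ * Fintype.card F ^ d := by
      intro j
      refine hC₁ F _ (fun e' he' => (hX e' he').mono (Finset.filter_subset _ _)) ?_
      rw [← Nat.lt_succ_iff]
      refine lt_of_lt_of_le (Finset.card_lt_card ?_) hm
      refine Finset.ssubset_iff_of_subset (fun e' he' => ?_) |>.mpr ⟨e, by simp [he, hdep], ?_⟩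
      · simp only [Finset.mem_filter, Finset.mem_univ, true_and] at he' ⊢
        exact ⟨he'.1, fun h => he'.2 (h.mono (Finset.filter_subset _ _))⟩
      · simp only [Finset.mem_filter, Finset.mem_univ, true_and, not_and, not_not]
        exact fun _ => ⟨c j, hc0 j, hcD j, fun x hx => (Finset.mem_filter.mp hx).2⟩
    calc X.card ≤ _ := Finset.card_le_card hsub
      _ ≤ _ := Finset.card_union_le _ _
      _ ≤ (D + 1) ^ Fintype.card σ * Fintype.card F ^ d +
          Fintype.card σ * (C₁ * Fintype.card F ^ d) := by
        refine Nat.add_le_add h1 (Finset.card_biUnion_le.trans ?_)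
        refine (Finset.sum_le_card_nsmul _ _ _ fun j _ => h2 j).trans (by simp)
      _ ≤ _ := by
        have : 0 ≤ C₀ * Fintype.card F ^ d := Nat.zero_le _
        nlinarith

/-- If any `d + 1` coordinates are dependent on `X`, then `X` has `O(q ^ d)` points. -/
theorem exists_card_le_of_coordDependent (σ : Type) [Fintype σ] (D d : ℕ) :
    ∃ C : ℕ, ∀ (F : Type) [Field F] [Fintype F] (X : Finset (σ → F)),
      (∀ e : Fin (d + 1) → σ, Function.Injective e → CoordDependent D X e) →
      X.card ≤ C * Fintype.card F ^ d := by
  classical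
  induction d with
  | zero => exact exists_card_le_aux σ D 0 ⟨0, fun F _ _ X h => by
      obtain ⟨f, hf0, -, hf⟩ := h Fin.elim0 (fun a => a.elim0)
      suffices hX : X = ∅ by simp [hX]
      by_contra hX
      obtain ⟨x, hx⟩ := Finset.nonempty_iff_ne_empty.mpr hX
      have := hf x hx
      rw [MvPolynomial.eq_C_of_isEmpty f] at this hf0
      simp at this hf0
      exact hf0 this⟩
  | succ d ih => exact exists_card_le_aux σ D (d + 1) (by
      obtain ⟨C, hC⟩ := ih
      refine ⟨C, fun F _ _ X h => (hC F X h).trans ?_⟩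
      exact Nat.mul_le_mul_left _ (Nat.pow_le_pow_right Fintype.card_pos (Nat.le_succ _)))

theorem exists_rename_mul_pow_mem_span {σ : Type} (E : Set (MvPolynomial σ ℤ))
    (g : MvPolynomial σ ℤ) {m : ℕ} (e : Fin m → σ)
    (h : ∀ (L : Type) [Field L] [CharZero L] (y : σ → L), (∀ f ∈ E, MvPolynomial.aeval y f = 0) →
      MvPolynomial.aeval y g ≠ 0 → ¬ AlgebraicIndependent ℚ (y ∘ e)) :
    ∃ f : MvPolynomial (Fin m) ℤ, f ≠ 0 ∧ ∃ k : ℕ, MvPolynomial.rename e f * g ^ k ∈ Ideal.span E := by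
  by_contra! hcon
  let S : Submonoid (MvPolynomial σ ℤ) :=
    { carrier := {q | ∃ f : MvPolynomial (Fin m) ℤ, f ≠ 0 ∧ ∃ k : ℕ, q = MvPolynomial.rename e f * g ^ k}
      one_mem' := ⟨1, one_ne_zero, 0, by simp⟩
      mul_mem' := by
        rintro _ _ ⟨f₁, h₁, k₁, rfl⟩ ⟨f₂, h₂, k₂, rfl⟩
        exact ⟨f₁ * f₂, mul_ne_zero h₁ h₂, k₁ + k₂, by rw [map_mul, pow_add]; ring⟩ }
  have hdisj : Disjoint (Ideal.span E : Set (MvPolynomial σ ℤ)) S := by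
    rw [Set.disjoint_left]
    rintro _ hq ⟨f, hf, k, rfl⟩
    exact hcon f hf k hq
  obtain ⟨𝔭, h𝔭, hle, hS⟩ := Ideal.exists_le_prime_disjoint _ S hdisj
  rw [Set.disjoint_right] at hS
  obtain ⟨L, _, φ, hφ⟩ : ∃ (L : Type) (_ : Field L) (φ : MvPolynomial σ ℤ →+* L),
      ∀ q, φ q = 0 ↔ q ∈ 𝔭 :=
    ⟨FractionRing (MvPolynomial σ ℤ ⧸ 𝔭), inferInstance,
      (algebraMap (MvPolynomial σ ℤ ⧸ 𝔭) _).comp (Ideal.Quotient.mk 𝔭), fun q => by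
        rw [← Ideal.Quotient.eq_zero_iff_mem]
        exact IsFractionRing.to_map_eq_zero_iff (R := MvPolynomial σ ℤ ⧸ 𝔭)⟩
  let y : σ → L := fun i => φ (MvPolynomial.X i)
  have hy : ∀ q : MvPolynomial σ ℤ, MvPolynomial.aeval y q = φ q := by
    intro q
    have : (MvPolynomial.aeval y : MvPolynomial σ ℤ →ₐ[ℤ] L).toRingHom = φ := by
      refine MvPolynomial.ringHom_ext (fun n => ?_) fun i => ?_ <;> simp [y]
    exact RingHom.congr_fun this q
  have hren : ∀ f : MvPolynomial (Fin m) ℤ, f ≠ 0 → MvPolynomial.aeval (y ∘ e) f ≠ 0 := by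
    intro f hf h0
    rw [← MvPolynomial.aeval_rename, hy, hφ] at h0
    exact hS ⟨f, hf, 0, by simp⟩ h0
  have hL : CharZero L := charZero_of_inj_zero fun n hn => by
    by_contra hn0
    refine hren (MvPolynomial.C (n : ℤ)) (by simpa using hn0) ?_
    simpa using hn
  refine h L y (fun f hf => ?_) (fun h0 => ?_) ?_
  · rw [hy, hφ]
    exact hle (Ideal.subset_span hf)
  · rw [hy, hφ] at h0
    exact hS ⟨1, one_ne_zero, 1, by simp⟩ h0
  · have : Algebra.IsAlgebraic ℤ ℚ :=
      (IsFractionRing.comap_isAlgebraic_iff (A := ℤ) (K := ℚ) (C := ℚ)).mpr inferInstance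
    refine AlgebraicIndependent.extendScalars (R := ℤ) ℚ ?_
    rw [algebraicIndependent_iff]
    intro f hf
    by_contra hf0
    exact hren f hf0 hf

/-- If over every field of characteristic zero the locus `E = 0`, `g ≠ 0` has no `d + 1`
algebraically independent coordinates, then it has `O(p ^ d)` points modulo `p`. -/
theorem exists_card_le_of_generic {σ : Type} [Fintype σ] (E : Set (MvPolynomial σ ℤ))
    (g : MvPolynomial σ ℤ) (d : ℕ)
    (h : ∀ (L : Type) [Field L] [CharZero L] (y : σ → L), (∀ f ∈ E, MvPolynomial.aeval y f = 0) →
      MvPolynomial.aeval y g ≠ 0 → ∀ e : Fin (d + 1) → σ, Function.Injective e →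
      ¬ AlgebraicIndependent ℚ (y ∘ e)) :
    ∃ C p₀ : ℕ, ∀ (p : ℕ) [Fact p.Prime], p₀ < p → ∀ X : Finset (σ → ZMod p),
      (∀ y ∈ X, (∀ f ∈ E, MvPolynomial.aeval y f = 0) ∧ MvPolynomial.aeval y g ≠ 0) → X.card ≤ C * p ^ d := by
  classical
  have key : ∀ e : Fin (d + 1) → σ, ∃ D p₀ : ℕ, Function.Injective e →
      ∀ (p : ℕ) [Fact p.Prime], p₀ < p → ∀ X : Finset (σ → ZMod p),
      (∀ y ∈ X, (∀ f ∈ E, MvPolynomial.aeval y f = 0) ∧ MvPolynomial.aeval y g ≠ 0) → CoordDependent D X e := by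
    intro e
    by_cases he : Function.Injective e
    · obtain ⟨f, hf0, k, hfk⟩ := exists_rename_mul_pow_mem_span E g e
        fun L _ _ y hE hg => h L y hE hg e he
      obtain ⟨s, hs⟩ := MvPolynomial.ne_zero_iff.mp hf0
      refine ⟨f.totalDegree, (MvPolynomial.coeff s f).natAbs, fun _ p _ hp X hX =>
        ⟨MvPolynomial.map (Int.castRingHom (ZMod p)) f, ?_, ?_, fun y hy => ?_⟩⟩
      · refine MvPolynomial.ne_zero_iff.mpr ⟨s, ?_⟩
        rw [MvPolynomial.coeff_map, eq_intCast, Ne, ZMod.intCast_zmod_eq_zero_iff_dvd]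
        intro hdvd
        exact absurd (Nat.le_of_dvd (Int.natAbs_pos.mpr hs) (Int.natCast_dvd.mp hdvd))
          (not_le.mpr hp)
      · have hsupp := MvPolynomial.support_map_subset (f := Int.castRingHom (ZMod p)) (p := f)
        exact Finset.sup_mono hsupp
      · obtain ⟨hE, hg⟩ := hX y hy
        have hker : Ideal.span E ≤ RingHom.ker (MvPolynomial.aeval y : MvPolynomial σ ℤ →ₐ[ℤ] ZMod p) :=
          Ideal.span_le.mpr hE
        have := hker hfk
        rw [RingHom.mem_ker, map_mul, map_pow, MvPolynomial.aeval_rename] at this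
        rw [MvPolynomial.eval_map]
        exact (mul_eq_zero.mp this).resolve_right (pow_ne_zero _ hg)
    · exact ⟨0, 0, fun h => absurd h he⟩
  choose D p₀ hD using key
  obtain ⟨C, hC⟩ := exists_card_le_of_coordDependent σ (Finset.univ.sup D) d
  refine ⟨C, Finset.univ.sup p₀, fun p _ hp X hX => ?_⟩
  have := hC (ZMod p) X fun e he => ?_
  · simpa [ZMod.card] using this
  · obtain ⟨f, h0, h1, h2⟩ := hD e he p
      (lt_of_le_of_lt (Finset.le_sup (Finset.mem_univ e)) hp) X hX
    exact ⟨f, h0, h1.trans (Finset.le_sup (Finset.mem_univ e)), h2⟩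

open KaehlerDifferential in
theorem linearIndependent_D_of_isTranscendenceBasis {L ι : Type} [Field L] [Algebra ℚ L]
    {x : ι → L} (hx : IsTranscendenceBasis ℚ x) :
    LinearIndependent L fun i => D ℚ L (x i) := by
  have := algebraRat.charZero L
  let S := MvPolynomial ι ℚ
  let : Algebra S L := (MvPolynomial.aeval x : S →ₐ[ℚ] L).toAlgebra
  have hSL : ∀ q : S, algebraMap S L q = MvPolynomial.aeval x q := fun q => rfl
  have : IsScalarTower ℚ S L := .of_algebraMap_eq' (MvPolynomial.aeval x : S →ₐ[ℚ] L).comp_algebraMap.symm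
  have : FaithfulSMul S L := (faithfulSMul_iff_algebraMap_injective S L).mpr hx.1
  have hSalg : Algebra.IsAlgebraic S L := by
    have := hx.isAlgebraic
    exact Algebra.IsAlgebraic.of_ringHom_of_comp_eq (S := Algebra.adjoin ℚ (Set.range x)) (B := L)
      hx.1.aevalEquiv (RingHom.id L) hx.1.aevalEquiv.surjective Function.injective_id
      (RingHom.ext fun q => hx.1.algebraMap_aevalEquiv q)
  let K := FractionRing S
  let : Algebra K L := FractionRing.liftAlgebra S L
  have : IsScalarTower S K L := FractionRing.isScalarTower_liftAlgebra S L
  have : Algebra.IsAlgebraic K L :=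
    (IsFractionRing.comap_isAlgebraic_iff (A := S) (K := K) (C := L)).mp hSalg
  have : Algebra.FormallyEtale S K := .of_isLocalization (nonZeroDivisors S)
  have : Algebra.FormallyEtale K L := .of_isSeparable K L
  have : Algebra.FormallyEtale S L := .comp S K L
  have h := ((mvPolynomialBasis ℚ ι).baseChange L).linearIndependent.map'
    (tensorKaehlerEquivOfFormallyEtale ℚ S L).toLinearMap (LinearEquiv.ker _)
  have hcomp : (tensorKaehlerEquivOfFormallyEtale ℚ S L).toLinearMap ∘
      (mvPolynomialBasis ℚ ι).baseChange L = fun i => D ℚ L (x i) := by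
    funext i
    change tensorKaehlerEquivOfFormallyEtale ℚ S L _ = _
    rw [Module.Basis.baseChange_apply, mvPolynomialBasis_apply, ← LinearEquiv.eq_symm_apply,
      ← MvPolynomial.aeval_X (R := ℚ) x i, ← hSL,
      tensorKaehlerEquivOfFormallyEtale_symm_D_algebraMap]
  rw [hcomp] at h
  exact h

open KaehlerDifferential in
theorem linearIndependent_D_of_algebraicIndependent {L ι : Type} [Field L] [Algebra ℚ L]
    {x : ι → L} (hx : AlgebraicIndependent ℚ x) :
    LinearIndependent L fun i => D ℚ L (x i) := by
  obtain ⟨t, hst, ht⟩ := exists_isTranscendenceBasis_superset hx.to_subtype_range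
  exact (linearIndependent_D_of_isTranscendenceBasis ht).comp
    (fun i => (⟨x i, hst (Set.mem_range_self i)⟩ : t))
    fun i j hij => hx.injective (congrArg Subtype.val hij)

theorem exists_pow_mul_wronskian {π a b u : ℚ[X]} (hπ : Irreducible π) {n : ℕ}
    (hb : ¬ π ∣ b) (hu : ¬ π ∣ u) (ha : a = π ^ (n + 1) * u) :
    ∃ w, ¬ π ∣ w ∧ derivative a * b - a * derivative b = π ^ n * w := by
  refine ⟨((n + 1 : ℕ) : ℚ[X]) * derivative π * u * b +
    π * (derivative u * b - u * derivative b), fun h => ?_, ?_⟩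
  · have hp := hπ.prime
    rw [dvd_add_left (dvd_mul_right _ _)] at h
    rcases hp.dvd_or_dvd h with h | h
    · rcases hp.dvd_or_dvd h with h | h
      · rcases hp.dvd_or_dvd h with h | h
        · refine hp.not_isUnit (isUnit_of_dvd_unit h ?_)
          rw [← Polynomial.C_eq_natCast]
          exact Polynomial.isUnit_C.mpr (isUnit_iff_ne_zero.mpr (by positivity))
        · have hs : IsCoprime π (derivative π) := hπ.separable
          exact hp.not_isUnit (hs.isUnit_of_dvd' dvd_rfl h)
      · exact hu h
    · exact hb h
  · subst ha
    simp only [derivative_mul, derivative_pow, Nat.add_sub_cancel, Polynomial.C_eq_natCast]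
    push_cast
    ring

theorem derivative_eq_zero_of_logDeriv_eq {a b c d : ℚ[X]} (ha : a ≠ 0) (hd : d ≠ 0)
    (hab : IsCoprime a b) (hcd : IsCoprime c d)
    (h : (derivative a * b - a * derivative b) * d ^ 2 =
      a * b * (derivative c * d - c * derivative d)) : derivative a = 0 := by
  by_cases hunit : IsUnit a
  · obtain ⟨r, -, rfl⟩ := Polynomial.isUnit_iff.mp hunit
    exact derivative_C
  exfalso
  obtain ⟨π, hπ, hdvd⟩ := WfDvdMonoid.exists_irreducible_factor hunit ha
  have hp := hπ.prime
  have hb : ¬ π ∣ b := fun hb => hp.not_isUnit (hab.isUnit_of_dvd' hdvd hb)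
  obtain ⟨n, u, hu, hau⟩ := WfDvdMonoid.max_power_factor ha hπ
  obtain ⟨m, v, hv, hdv⟩ := WfDvdMonoid.max_power_factor hd hπ
  obtain _ | n := n
  · exact hu (by simpa [hau] using hdvd)
  obtain ⟨w, hw, hW⟩ := exists_pow_mul_wronskian hπ hb hu hau
  rw [hW] at h
  have hπ0 : ∀ k : ℕ, π ^ k ≠ 0 := fun k => pow_ne_zero k hp.ne_zero
  obtain _ | m := m
  · have h' : w * d ^ 2 = π * (u * b * (derivative c * d - c * derivative d)) :=
      mul_left_cancel₀ (hπ0 n) (by rw [← mul_assoc, h, hau]; ring)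
    rw [pow_zero, one_mul] at hdv
    rcases hp.dvd_or_dvd (Dvd.intro _ h'.symm) with h | h
    · exact hw h
    · exact hv (hdv ▸ hp.dvd_of_dvd_pow h)
  · have hc : ¬ π ∣ c := fun hc => hp.not_isUnit
      (hcd.isUnit_of_dvd' hc (hdv ▸ Dvd.dvd.mul_right (dvd_pow_self π m.succ_ne_zero) v))
    obtain ⟨w', hw', hW'⟩ := exists_pow_mul_wronskian hπ hc hv hdv
    have h' : π * (π ^ m * w * v ^ 2) = -(u * b * w') :=
      mul_left_cancel₀ (hπ0 (n + 1 + m)) (by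
        have hW'' : derivative c * d - c * derivative d = -(π ^ m * w') := by rw [← hW']; ring
        rw [hW'', hau, hdv] at h
        linear_combination h)
    rcases hp.dvd_or_dvd ((dvd_neg.mp (Dvd.intro _ h'))) with h | h
    · exact (hp.dvd_or_dvd h).elim hu hb
    · exact hw' h

theorem transcendental_of_forall_ne_C {f : RatFunc ℚ} (hf : ¬ ∃ c, f = RatFunc.C c) :
    Transcendental ℚ f := by
  have h := RatFunc.transcendental_of_ne_C f hf
  rwa [Subsingleton.elim (RatFunc.instAlgebraOfPolynomial ℚ ℚ) DivisionRing.toRatAlgebra] at h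

theorem Derivation.map_ratFunc_eq_smul (δ : Derivation ℚ (RatFunc ℚ) (RatFunc ℚ))
    (hδ : δ RatFunc.X = 1) {L V : Type} [Field L] [Algebra ℚ L] [AddCommGroup V] [Module L V]
    [Module ℚ V] (D : Derivation ℚ L V) (ε : RatFunc ℚ →ₐ[ℚ] L) (f : RatFunc ℚ) :
    D (ε f) = ε (δ f) • D (ε RatFunc.X) := by
  have hX : ∀ a : ℚ[X], algebraMap ℚ[X] (RatFunc ℚ) a = aeval RatFunc.X a := fun a => by
    rw [← RatFunc.algebraMap_X, aeval_algebraMap_apply, aeval_X_left_apply]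
  have hδa : ∀ a : ℚ[X], δ (algebraMap ℚ[X] (RatFunc ℚ) a) =
      algebraMap ℚ[X] (RatFunc ℚ) (derivative a) := fun a => by
    rw [hX, hX, Derivation.map_aeval, hδ, smul_eq_mul, mul_one]
  have hD : ∀ a : ℚ[X], D (ε (algebraMap ℚ[X] (RatFunc ℚ) a)) =
      ε (δ (algebraMap ℚ[X] (RatFunc ℚ) a)) • D (ε RatFunc.X) := fun a => by
    rw [hδa, hX, hX, ← aeval_algHom_apply ε, ← aeval_algHom_apply ε, Derivation.map_aeval]
  conv_lhs => rw [← RatFunc.num_div_denom f]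
  conv_rhs => rw [← RatFunc.num_div_denom f]
  rw [map_div₀, Derivation.leibniz_div, Derivation.leibniz_div, hD, hD]
  simp only [smul_eq_mul, map_mul, map_sub, map_pow, map_inv₀, smul_smul, ← sub_smul]

theorem exists_derivation_ratFunc : ∃ δ : Derivation ℚ (RatFunc ℚ) (RatFunc ℚ),
    δ RatFunc.X = 1 := by
  have hX : Transcendental ℚ (RatFunc.X : RatFunc ℚ) := by
    refine transcendental_of_forall_ne_C ?_
    rintro ⟨c, hc⟩
    refine Polynomial.X_ne_C c (RatFunc.algebraMap_injective ℚ ?_)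
    rw [RatFunc.algebraMap_X, RatFunc.algebraMap_C, hc]
  have h0 : KaehlerDifferential.D ℚ (RatFunc ℚ) RatFunc.X ≠ 0 :=
    (linearIndependent_D_of_algebraicIndependent (ι := Fin 1) (x := fun _ => RatFunc.X)
      (by rwa [algebraicIndependent_unique_type_iff])).ne_zero 0
  obtain ⟨φ, hφ⟩ : ∃ φ : Module.Dual (RatFunc ℚ) (Ω[RatFunc ℚ⁄ℚ]),
      φ (KaehlerDifferential.D ℚ (RatFunc ℚ) RatFunc.X) ≠ 0 := by
    by_contra! h
    exact h0 ((Module.forall_dual_apply_eq_zero_iff (RatFunc ℚ) _).mp h)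
  refine ⟨((φ (KaehlerDifferential.D ℚ (RatFunc ℚ) RatFunc.X))⁻¹ • φ).compDer
    (KaehlerDifferential.D ℚ (RatFunc ℚ)), ?_⟩
  simp [hφ]

theorem exists_eq_C_of_derivation_eq_zero (δ : Derivation ℚ (RatFunc ℚ) (RatFunc ℚ))
    (hδ : δ RatFunc.X = 1) {f : RatFunc ℚ} (hf : δ f = 0) : ∃ c : ℚ, f = RatFunc.C c := by
  by_contra hC
  refine (linearIndependent_D_of_algebraicIndependent (ι := Fin 1) (x := fun _ => f)
      ?_).ne_zero 0 ?_
  · rw [algebraicIndependent_unique_type_iff]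
    exact transcendental_of_forall_ne_C hC
  · simpa [hf] using Derivation.map_ratFunc_eq_smul δ hδ
      (KaehlerDifferential.D ℚ (RatFunc ℚ)) (AlgHom.id ℚ _) f

theorem derivation_eq_zero_of_eq_mul (δ : Derivation ℚ (RatFunc ℚ) (RatFunc ℚ))
    (hδ : δ RatFunc.X = 1) {R G : RatFunc ℚ} (h : δ R = R * δ G) : δ R = 0 := by
  by_cases hR : R = 0
  · simp [hR]
  have hδa : ∀ a : ℚ[X], δ (algebraMap ℚ[X] (RatFunc ℚ) a) =
      algebraMap ℚ[X] (RatFunc ℚ) (derivative a) := fun a => by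
    have hX : ∀ a : ℚ[X], algebraMap ℚ[X] (RatFunc ℚ) a = aeval RatFunc.X a := fun a => by
      rw [← RatFunc.algebraMap_X, aeval_algebraMap_apply, aeval_X_left_apply]
    rw [hX, hX, Derivation.map_aeval, hδ, smul_eq_mul, mul_one]
  have hne : ∀ f : RatFunc ℚ, algebraMap ℚ[X] (RatFunc ℚ) f.denom ≠ 0 := fun f =>
    RatFunc.algebraMap_ne_zero f.denom_ne_zero
  have hq : ∀ f : RatFunc ℚ, δ f = algebraMap ℚ[X] (RatFunc ℚ)
      (derivative f.num * f.denom - f.num * derivative f.denom) /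
        algebraMap ℚ[X] (RatFunc ℚ) f.denom ^ 2 := fun f => by
    have hf := hne f
    conv_lhs => rw [← RatFunc.num_div_denom f]
    rw [Derivation.leibniz_div, hδa, hδa]
    simp only [smul_eq_mul, map_sub, map_mul]
    field_simp
  have hpoly : (derivative R.num * R.denom - R.num * derivative R.denom) * G.denom ^ 2 =
      R.num * R.denom * (derivative G.num * G.denom - G.num * derivative G.denom) := by
    refine RatFunc.algebraMap_injective ℚ ?_
    have hR' := hne R
    have hG' := hne G
    rw [hq R, hq G] at h
    have h2 := congrArg (· * (algebraMap ℚ[X] (RatFunc ℚ) R.denom ^ 2 *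
      algebraMap ℚ[X] (RatFunc ℚ) G.denom ^ 2)) h
    have h3 : R * algebraMap ℚ[X] (RatFunc ℚ) R.denom = algebraMap ℚ[X] (RatFunc ℚ) R.num := by
      rw [← eq_div_iff hR', RatFunc.num_div_denom]
    rw [map_mul, map_mul, map_mul, map_pow, ← h3]
    field_simp at h2
    linear_combination h2
  have hnum := derivative_eq_zero_of_logDeriv_eq (RatFunc.num_ne_zero hR) G.denom_ne_zero
    R.isCoprime_num_denom G.isCoprime_num_denom hpoly
  have hden := derivative_eq_zero_of_logDeriv_eq (a := R.denom) (b := R.num) (c := -G.num)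
    R.denom_ne_zero G.denom_ne_zero
    R.isCoprime_num_denom.symm G.isCoprime_num_denom.neg_left
    (by rw [derivative_neg]; linear_combination -hpoly)
  rw [hq, hnum, hden]
  simp

/-- The differential relations between the values `u = P(y)`, `v = Q(y)` at a point `y` and the
values there of `R = dQ/dP`, `h = dR/(R dP)`, `g = dh/dR`. -/
structure IsJet {L V : Type} [Field L] [Algebra ℚ L] [AddCommGroup V] [Module L V] [Module ℚ V]
    (D : Derivation ℚ L V) (u v R h g k : L) : Prop where
  R_ne_zero : R ≠ 0
  h_ne_zero : h ≠ 0
  k_ne_zero : k ≠ 0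
  map_v : D v = R • D u
  map_R : D R = (R * h) • D u
  map_h : D h = (g * R * h) • D u
  map_g : D g = k • D u

theorem exists_ratFunc_jet (δ : Derivation ℚ (RatFunc ℚ) (RatFunc ℚ)) (hδ : δ RatFunc.X = 1)
    {P Q : RatFunc ℚ} (hPQ : LinearIndependent ℚ ![P, Q, (1 : RatFunc ℚ)]) :
    δ P ≠ 0 ∧ ∃ R h g k : RatFunc ℚ, R ≠ 0 ∧ h ≠ 0 ∧ k ≠ 0 ∧ δ Q = R * δ P ∧
      δ R = R * h * δ P ∧ δ h = g * R * h * δ P ∧ δ g = k * δ P := by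
  have hcast : ∀ c : ℚ, (RatFunc.C c : RatFunc ℚ) = algebraMap ℚ (RatFunc ℚ) c := fun c => by
    rw [eq_ratCast, eq_ratCast]
  have hlin : ∀ a b c : ℚ, RatFunc.C a * P + RatFunc.C b * Q = RatFunc.C c → a = 0 ∧ b = 0 := by
    intro a b c h
    have := Fintype.linearIndependent_iff.mp hPQ ![a, b, -c] (by
      rw [hcast, hcast, hcast] at h
      rw [Fin.sum_univ_three]
      rw [Algebra.smul_def, Algebra.smul_def, Algebra.smul_def]
      change algebraMap ℚ (RatFunc ℚ) a * P + algebraMap ℚ (RatFunc ℚ) b * Q +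
        algebraMap ℚ (RatFunc ℚ) (-c) * 1 = 0
      rw [h, map_neg, mul_one, add_neg_cancel])
    exact ⟨by simpa using this 0, by simpa using this 1⟩
  have hP : δ P ≠ 0 := fun h => by
    obtain ⟨c, hc⟩ := exists_eq_C_of_derivation_eq_zero δ hδ h
    refine one_ne_zero (hlin 1 0 c ?_).1
    rw [map_one, map_zero, hc]; ring
  have hQ : δ Q ≠ 0 := fun h => by
    obtain ⟨c, hc⟩ := exists_eq_C_of_derivation_eq_zero δ hδ h
    refine one_ne_zero (hlin 0 1 c ?_).2
    rw [map_one, map_zero, hc]; ring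
  have hC : ∀ c : ℚ, ∀ f, δ (RatFunc.C c * f) = RatFunc.C c * δ f := fun c f => by
    rw [hcast, Derivation.leibniz, Derivation.map_algebraMap, smul_zero, add_zero, smul_eq_mul]
  set R := δ Q / δ P with hRdef
  have hR0 : R ≠ 0 := div_ne_zero hQ hP
  have hRP : δ Q = R * δ P := (div_mul_cancel₀ _ hP).symm
  have hR : δ R ≠ 0 := fun h => by
    obtain ⟨c, hc⟩ := exists_eq_C_of_derivation_eq_zero δ hδ h
    have h1 : δ (Q - RatFunc.C c * P) = 0 := by rw [map_sub, hC, hRP, hc, sub_self]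
    obtain ⟨e, he⟩ := exists_eq_C_of_derivation_eq_zero δ hδ h1
    have := (hlin (-c) 1 e (by rw [← he, map_neg, map_one]; ring)).2
    exact one_ne_zero this
  set h := δ R / (R * δ P) with hhdef
  have hh0 : h ≠ 0 := div_ne_zero hR (mul_ne_zero hR0 hP)
  have hRh : δ R = R * h * δ P := by rw [hhdef]; field_simp
  set g := δ h / δ R with hgdef
  have hgh : δ h = g * δ R := (div_mul_cancel₀ _ hR).symm
  refine ⟨hP, R, h, g, δ g / δ P, hR0, hh0, div_ne_zero (fun hg => ?_) hP, hRP, hRh,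
    by rw [hgh, hRh]; ring, (div_mul_cancel₀ _ hP).symm⟩
  obtain ⟨A, hA⟩ := exists_eq_C_of_derivation_eq_zero δ hδ hg
  have h1 : δ (h - RatFunc.C A * R) = 0 := by rw [map_sub, hC, hgh, hA, sub_self]
  obtain ⟨B, hB⟩ := exists_eq_C_of_derivation_eq_zero δ hδ h1
  refine hR (derivation_eq_zero_of_eq_mul δ hδ (G := RatFunc.C A * Q + RatFunc.C B * P) ?_)
  rw [map_add, hC, hC, hRP, ← hB, hRh]
  ring

theorem Derivation.map_eq_zero_of_isAlgebraic {L V : Type} [Field L] [Algebra ℚ L]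
    [AddCommGroup V] [Module L V] [Module ℚ V] (D : Derivation ℚ L V) {y : L}
    (hy : IsAlgebraic ℚ y) : D y = 0 := by
  have h := D.map_aeval (minpoly ℚ y) y
  rw [minpoly.aeval, map_zero, eq_comm, smul_eq_zero] at h
  exact h.resolve_left ((minpoly.irreducible hy.isIntegral).separable.aeval_derivative_ne_zero
    (minpoly.aeval ℚ y))

/-- Value of a rational function at a point of an extension of `ℚ`. -/
def evalIn {L : Type} [Field L] [Algebra ℚ L] (P : RatFunc ℚ) (y : L) : L :=
  aeval y P.num / aeval y P.denom

theorem exists_isJet {P Q : RatFunc ℚ} (hPQ : LinearIndependent ℚ ![P, Q, (1 : RatFunc ℚ)])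
    {L V : Type} [Field L] [Algebra ℚ L] [AddCommGroup V] [Module L V] [Module ℚ V]
    (D : Derivation ℚ L V) (y : L) :
    ∃ c R h g k : L, c ≠ 0 ∧ D (evalIn P y) = c • D y ∧
      IsJet D (evalIn P y) (evalIn Q y) R h g k := by
  by_cases hy : IsAlgebraic ℚ y
  · have h0 : ∀ f : RatFunc ℚ, D (evalIn f y) = 0 := fun f => by
      rw [evalIn, Derivation.leibniz_div, Derivation.map_aeval, Derivation.map_aeval,
        Derivation.map_eq_zero_of_isAlgebraic D hy]
      simp
    refine ⟨1, 1, 1, 0, 1, one_ne_zero, ?_, one_ne_zero, one_ne_zero, one_ne_zero, ?_, ?_, ?_, ?_⟩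
    all_goals simp [h0, Derivation.map_eq_zero_of_isAlgebraic D hy]
  · obtain ⟨δ, hδ⟩ := exists_derivation_ratFunc
    obtain ⟨hP, R, h, g, k, hR0, hh0, hk0, h1, h2, h3, h4⟩ := exists_ratFunc_jet δ hδ hPQ
    have hinj : Function.Injective (aeval y : ℚ[X] →ₐ[ℚ] L) :=
      transcendental_iff_injective.mp hy
    let ε : RatFunc ℚ →ₐ[ℚ] L := (RatFunc.liftRingHom (aeval y : ℚ[X] →ₐ[ℚ] L).toRingHom
      (nonZeroDivisors_le_comap_nonZeroDivisors_of_injective _ hinj)).toRatAlgHom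
    have hε : ∀ f, ε f = evalIn f y := fun f => RatFunc.liftRingHom_apply _ _ _
    have hεX : ε RatFunc.X = y := by rw [hε, evalIn]; simp
    have hD := Derivation.map_ratFunc_eq_smul δ hδ D ε
    have hDP : ∀ f e : RatFunc ℚ, δ f = e * δ P → D (ε f) = ε e • D (ε P) := fun f e hf => by
      rw [hD, hD P, hf, map_mul, mul_smul]
    refine ⟨ε (δ P), ε R, ε h, ε g, ε k, by simpa using hP, by rw [← hε, hD, hεX], ?_⟩
    rw [← hε, ← hε]
    exact ⟨by simpa using hR0, by simpa using hh0, by simpa using hk0, hDP _ _ h1,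
      by simpa using hDP _ _ h2, by simpa using hDP _ _ h3, hDP _ _ h4⟩

section RelationRank

variable {L V : Type} [Field L] [AddCommGroup V] [Module L V]

theorem exists_eq_smul_of_three_le_finrank {ω : Fin 4 → V}
    (hω : 3 ≤ Module.finrank L (Submodule.span L (Set.range ω))) {c c' : Fin 4 → L}
    (hc : ∑ i, c i • ω i = 0) (hc' : ∑ i, c' i • ω i = 0) (h0 : c ≠ 0) : ∃ r : L, c' = r • c := by
  have hrank := LinearMap.finrank_range_add_finrank_ker (Fintype.linearCombination L ω)
  rw [Fintype.range_linearCombination, Module.finrank_fin_fun] at hrank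
  have hker : Module.finrank L (LinearMap.ker (Fintype.linearCombination L ω)) ≤ 1 := by omega
  obtain ⟨v, hv⟩ := finrank_le_one_iff.mp hker
  have mem : ∀ b : Fin 4 → L, ∑ i, b i • ω i = 0 → ∃ a : L, b = a • (v : Fin 4 → L) := by
    intro b hb
    obtain ⟨a, ha⟩ := hv ⟨b, by simpa [Fintype.linearCombination_apply] using hb⟩
    exact ⟨a, by simpa using (congrArg Subtype.val ha).symm⟩
  obtain ⟨a, rfl⟩ := mem c hc
  obtain ⟨b, rfl⟩ := mem c' hc'
  have ha : a ≠ 0 := by rintro rfl; simp at h0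
  exact ⟨b / a, by rw [smul_smul, div_mul_cancel₀ _ ha]⟩

theorem exists_dual_of_notMem {W : Submodule L V} {x : V} (hx : x ∉ W) :
    ∃ φ : Module.Dual L V, φ x ≠ 0 ∧ ∀ w ∈ W, φ w = 0 := by
  obtain ⟨φ, hφ, hW⟩ := Submodule.exists_dual_map_eq_bot_of_notMem hx inferInstance
  refine ⟨φ, hφ, fun w hw => ?_⟩
  have : φ w ∈ Submodule.map φ W := Submodule.mem_map_of_mem hw
  rwa [hW, Submodule.mem_bot] at this

end RelationRank

section Configuration

variable {L V : Type} [Field L] [Algebra ℚ L] [AddCommGroup V] [Module L V] [Module ℚ V]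
  (D : Derivation ℚ L V)

/-- Span of the differentials of four quantities. -/
def diffSpan (u : Fin 4 → L) : Submodule L V :=
  Submodule.span L (Set.range fun i => D (u i))

/-- Span of the differentials of the differences along the edges of a four-cycle. -/
def edgeSpan (u v : Fin 4 → L) : Submodule L V :=
  Submodule.span L (Set.range ![D (u 0 - u 1), D (u 2 - u 3), D (v 0 - v 3), D (v 1 - v 2)])

/-- Span of the differentials of the alternating sums around a four-cycle. -/
def altSpan (u v : Fin 4 → L) : Submodule L V :=
  Submodule.span L (Set.range ![D (u 0 - u 1 + u 2 - u 3), D (v 0 - v 1 + v 2 - v 3)])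

instance (u : Fin 4 → L) : FiniteDimensional L (diffSpan D u) :=
  FiniteDimensional.span_of_finite L (Set.finite_range _)

instance (u v : Fin 4 → L) : FiniteDimensional L (edgeSpan D u v) :=
  FiniteDimensional.span_of_finite L (Set.finite_range _)

instance (u v : Fin 4 → L) : FiniteDimensional L (altSpan D u v) :=
  FiniteDimensional.span_of_finite L (Set.finite_range _)

theorem edge_mem_edgeSpan (u v : Fin 4 → L) :
    D (u 0 - u 1) ∈ edgeSpan D u v ∧ D (u 2 - u 3) ∈ edgeSpan D u v ∧
      D (v 0 - v 3) ∈ edgeSpan D u v ∧ D (v 1 - v 2) ∈ edgeSpan D u v :=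
  ⟨Submodule.subset_span ⟨0, rfl⟩, Submodule.subset_span ⟨1, rfl⟩,
    Submodule.subset_span ⟨2, rfl⟩, Submodule.subset_span ⟨3, rfl⟩⟩

theorem altSpan_le_edgeSpan (u v : Fin 4 → L) : altSpan D u v ≤ edgeSpan D u v := by
  obtain ⟨h1, h2, h3, h4⟩ := edge_mem_edgeSpan D u v
  refine Submodule.span_le.mpr ?_
  rintro _ ⟨i, rfl⟩
  fin_cases i
  · change D (u 0 - u 1 + u 2 - u 3) ∈ edgeSpan D u v
    rw [show u 0 - u 1 + u 2 - u 3 = (u 0 - u 1) + (u 2 - u 3) by ring, map_add]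
    exact add_mem h1 h2
  · change D (v 0 - v 1 + v 2 - v 3) ∈ edgeSpan D u v
    rw [show v 0 - v 1 + v 2 - v 3 = (v 0 - v 3) - (v 1 - v 2) by ring, map_sub]
    exact sub_mem h3 h4

theorem finrank_diffSpan_le (u : Fin 4 → L) : Module.finrank L (diffSpan D u) ≤ 4 :=
  (finrank_range_le_card (R := L) fun i => D (u i)).trans_eq (Fintype.card_fin 4)

variable {D} {u v R h g k : Fin 4 → L}

theorem edgeSpan_le_diffSpan
    (hj : ∀ i, IsJet D (u i) (v i) (R i) (h i) (g i) (k i)) : edgeSpan D u v ≤ diffSpan D u := by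
  have hu : ∀ i, D (u i) ∈ diffSpan D u := fun i => Submodule.subset_span ⟨i, rfl⟩
  have hv : ∀ i, D (v i) ∈ diffSpan D u := fun i => by
    rw [(hj i).map_v]; exact Submodule.smul_mem _ _ (hu i)
  refine Submodule.span_le.mpr ?_
  rintro _ ⟨i, rfl⟩
  fin_cases i <;> simp only [map_sub] <;> exact sub_mem (by simp [hu, hv]) (by simp [hu, hv])

theorem finrank_diffSpan_le_finrank_edgeSpan_add_one
    (hj : ∀ i, IsJet D (u i) (v i) (R i) (h i) (g i) (k i)) :
    Module.finrank L (diffSpan D u) ≤ Module.finrank L (edgeSpan D u v) + 1 := by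
  have hle : diffSpan D u ≤ edgeSpan D u v ⊔ Submodule.span L {D (u 0)} := by
    obtain ⟨h1, h2, h3, h4⟩ := edge_mem_edgeSpan D u v
    have hl : edgeSpan D u v ≤ edgeSpan D u v ⊔ Submodule.span L {D (u 0)} := le_sup_left
    have m0 : D (u 0) ∈ edgeSpan D u v ⊔ Submodule.span L {D (u 0)} :=
      Submodule.mem_sup_right (Submodule.mem_span_singleton_self _)
    have m1 : D (u 1) ∈ edgeSpan D u v ⊔ Submodule.span L {D (u 0)} := by
      simpa using sub_mem m0 (hl h1)
    have m3 : D (u 3) ∈ edgeSpan D u v ⊔ Submodule.span L {D (u 0)} := by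
      have := sub_mem (Submodule.smul_mem _ (R 0) m0) (hl h3)
      rw [map_sub, (hj 0).map_v, sub_sub_cancel, (hj 3).map_v] at this
      exact (Submodule.smul_mem_iff _ (hj 3).R_ne_zero).mp this
    have m2 : D (u 2) ∈ edgeSpan D u v ⊔ Submodule.span L {D (u 0)} := by
      simpa using add_mem (hl h2) m3
    refine Submodule.span_le.mpr ?_
    rintro _ ⟨i, rfl⟩
    fin_cases i <;> assumption
  refine (Submodule.finrank_mono hle).trans ((Submodule.finrank_add_le_finrank_add_finrank _ _).trans
    (Nat.add_le_add_left ?_ _))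
  exact (finrank_span_le_card ({D (u 0)} : Set V)).trans (by simp)

theorem finrank_diffSpan_le_one_of_eq
    (hj : ∀ i, IsJet D (u i) (v i) (R i) (h i) (g i) (k i)) {r : L} (hR : ∀ i, R i = r) :
    Module.finrank L (diffSpan D u) ≤ 1 := by
  have hle : diffSpan D u ≤ Submodule.span L {D (R 0)} := by
    refine Submodule.span_le.mpr ?_
    rintro _ ⟨i, rfl⟩
    have h1 : D (R 0) = (R i * h i) • D (u i) := by rw [hR 0, ← hR i, (hj i).map_R]
    have := Submodule.mem_span_singleton_self (R := L) (D (R 0))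
    rw [h1] at this ⊢
    exact (Submodule.smul_mem_iff _ (mul_ne_zero (hj i).R_ne_zero (hj i).h_ne_zero)).mp this
  exact (Submodule.finrank_mono hle).trans
    ((finrank_span_le_card ({D (R 0)} : Set V)).trans (by simp))

theorem exists_alt_relation
    (hj : ∀ i, IsJet D (u i) (v i) (R i) (h i) (g i) (k i))
    (ht : Module.finrank L (altSpan D u v) ≤ 1) :
    ∃ a b : L, (a ≠ 0 ∨ b ≠ 0) ∧
      ∑ i, ![a + b * R 0, -(a + b * R 1), a + b * R 2, -(a + b * R 3)] i • D (u i) = 0 := by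
  have hdep : ¬ LinearIndependent L
      ![D (u 0 - u 1 + u 2 - u 3), D (v 0 - v 1 + v 2 - v 3)] := fun hli => by
    have := finrank_span_eq_card hli
    rw [Fintype.card_fin] at this
    rw [altSpan] at ht
    omega
  rw [LinearIndependent.pair_iff] at hdep
  push Not at hdep
  obtain ⟨a, b, hab, hne⟩ := hdep
  refine ⟨a, b, by tauto, ?_⟩
  rw [← hab]
  simp only [map_sub, map_add, (hj _).map_v, Fin.sum_univ_four, Matrix.cons_val]
  module

theorem finrank_diffSpan_le_finrank_altSpan_add_two
    (hj : ∀ i, IsJet D (u i) (v i) (R i) (h i) (g i) (k i)) :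
    Module.finrank L (diffSpan D u) ≤ Module.finrank L (altSpan D u v) + 2 := by
  have h4 := finrank_diffSpan_le D u
  by_contra! hlt
  obtain ⟨a, b, hab, hrel⟩ := exists_alt_relation hj (by omega)
  by_cases ht : Module.finrank L (altSpan D u v) = 0
  · have ht' : altSpan D u v = ⊥ := Submodule.finrank_eq_zero.mp ht
    have hP : D (u 0 - u 1 + u 2 - u 3) = 0 := by
      have : D (u 0 - u 1 + u 2 - u 3) ∈ altSpan D u v := Submodule.subset_span ⟨0, rfl⟩
      rwa [ht', Submodule.mem_bot] at this
    have hQ : D (v 0 - v 1 + v 2 - v 3) = 0 := by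
      have : D (v 0 - v 1 + v 2 - v 3) ∈ altSpan D u v := Submodule.subset_span ⟨1, rfl⟩
      rwa [ht', Submodule.mem_bot] at this
    obtain ⟨r, hr⟩ := exists_eq_smul_of_three_le_finrank (L := L) (ω := fun i => D (u i))
      (c := ![1, -1, 1, -1]) (c' := ![R 0, -R 1, R 2, -R 3]) (by rw [diffSpan] at hlt; omega)
      (by rw [← hP]
          simp only [map_sub, map_add, Fin.sum_univ_four, Matrix.cons_val]
          module)
      (by rw [← hQ]
          simp only [map_sub, map_add, (hj _).map_v, Fin.sum_univ_four, Matrix.cons_val]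
          module)
      (fun h0 => one_ne_zero (congrFun h0 0))
    have := finrank_diffSpan_le_one_of_eq hj (r := r) fun i => by
      have := congrFun hr i
      fin_cases i <;> simpa using this
    omega
  · have hli : LinearIndependent L fun i => D (u i) := by
      rw [linearIndependent_iff_card_le_finrank_span, Set.finrank, Fintype.card_fin]
      rw [diffSpan] at hlt; omega
    have hz := Fintype.linearIndependent_iff.mp hli _ hrel
    have hz' : ∀ i, a + b * R i = 0 := fun i => by
      have := hz i
      fin_cases i <;> simpa [-neg_add_rev] using this
    have hb : b ≠ 0 := by
      rintro rfl
      have := hz' 0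
      rw [zero_mul, add_zero] at this
      exact hab.elim (fun h => h this) (fun h => h rfl)
    have := finrank_diffSpan_le_one_of_eq hj (r := -a / b) fun i => by
      rw [eq_div_iff hb]; linear_combination hz' i
    omega

theorem mul_eq_mul_of_edgeSpan_lt
    (hj : ∀ i, IsJet D (u i) (v i) (R i) (h i) (g i) (k i))
    (hlt : edgeSpan D u v < diffSpan D u) :
    R 0 * R 2 = R 1 * R 3 := by
  obtain ⟨x, hx, hxA⟩ := SetLike.exists_of_lt hlt
  obtain ⟨φ, hφx, hφ⟩ := exists_dual_of_notMem hxA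
  obtain ⟨h1, h2, h3, h4⟩ := edge_mem_edgeSpan D u v
  replace h1 := hφ _ h1
  replace h2 := hφ _ h2
  replace h3 := hφ _ h3
  replace h4 := hφ _ h4
  simp only [map_sub, (hj _).map_v, map_smul, smul_eq_mul] at h1 h2 h3 h4
  have ht : φ (D (u 2)) ≠ 0 := fun h0 => by
    have z3 : φ (D (u 3)) = 0 := by linear_combination h0 - h2
    have z0 : φ (D (u 0)) = 0 := by
      refine (mul_eq_zero.mp ?_).resolve_left (hj 0).R_ne_zero
      linear_combination h3 + R 3 * z3
    have z1 : φ (D (u 1)) = 0 := by linear_combination z0 - h1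
    have hle : diffSpan D u ≤ LinearMap.ker φ := by
      refine Submodule.span_le.mpr ?_
      rintro _ ⟨i, rfl⟩
      fin_cases i <;> assumption
    exact hφx (hle hx)
  refine mul_right_cancel₀ ht ?_
  linear_combination R 1 * h3 - R 0 * h4 - R 1 * R 0 * h1 - R 1 * R 3 * h2

theorem sum_dlog_eq_zero
    (hj : ∀ i, IsJet D (u i) (v i) (R i) (h i) (g i) (k i))
    (hR : R 0 * R 2 = R 1 * R 3) :
    ∑ i, ![h 0, -h 1, h 2, -h 3] i • D (u i) = 0 := by
  have hD := congrArg D hR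
  rw [Derivation.leibniz, Derivation.leibniz, (hj 0).map_R, (hj 1).map_R, (hj 2).map_R,
    (hj 3).map_R] at hD
  have : (R 0 * R 2) • ∑ i, ![h 0, -h 1, h 2, -h 3] i • D (u i) =
      (R 0 • (R 2 * h 2) • D (u 2) + R 2 • (R 0 * h 0) • D (u 0)) -
        (R 1 • (R 3 * h 3) • D (u 3) + R 3 • (R 1 * h 1) • D (u 1)) := by
    simp only [Fin.sum_univ_four, Matrix.cons_val, smul_add, smul_smul]
    rw [show R 0 * R 2 * -h 1 = -(R 3 * (R 1 * h 1)) by rw [hR]; ring,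
      show R 0 * R 2 * -h 3 = -(R 1 * (R 3 * h 3)) by rw [hR]; ring]
    module
  rw [hD, sub_self] at this
  exact (smul_eq_zero.mp this).resolve_left (mul_ne_zero (hj 0).R_ne_zero (hj 2).R_ne_zero)

theorem not_finrank_eq_of_altSpan_ne_zero
    (hj : ∀ i, IsJet D (u i) (v i) (R i) (h i) (g i) (k i))
    (ht : 1 ≤ Module.finrank L (altSpan D u v))
    (hY : Module.finrank L (diffSpan D u) = Module.finrank L (altSpan D u v) + 2) :
    Module.finrank L (edgeSpan D u v) ≠ Module.finrank L (altSpan D u v) + 1 := by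
  intro hA
  have hlt : edgeSpan D u v < diffSpan D u := lt_of_le_of_ne (edgeSpan_le_diffSpan hj) fun he => by
    rw [he] at hA; omega
  have hrel := sum_dlog_eq_zero hj (mul_eq_mul_of_edgeSpan_lt hj hlt)
  have hh0 : (![h 0, -h 1, h 2, -h 3] : Fin 4 → L) ≠ 0 :=
    fun h0 => (hj 0).h_ne_zero (congrFun h0 0)
  have h4 := finrank_diffSpan_le D u
  by_cases ht1 : Module.finrank L (altSpan D u v) = 1
  swap
  · have hli : LinearIndependent L fun i => D (u i) := by
      rw [linearIndependent_iff_card_le_finrank_span, Set.finrank, Fintype.card_fin]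
      rw [diffSpan] at hY; omega
    exact hh0 (funext fun i => Fintype.linearIndependent_iff.mp hli _ hrel i)
  have h3 : 3 ≤ Module.finrank L (Submodule.span L (Set.range fun i => D (u i))) := by
    rw [diffSpan] at hY; omega
  obtain ⟨a, b, hab, halt⟩ := exists_alt_relation hj ht1.le
  obtain ⟨r, hr⟩ := exists_eq_smul_of_three_le_finrank h3 hrel halt hh0
  have hr' : ∀ i, a + b * R i = r * h i := fun i => by
    have := congrFun hr i
    fin_cases i <;> simp [-neg_add_rev] at this <;> exact this
  have hr0 : r ≠ 0 := by
    rintro rfl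
    have hb : b ≠ 0 := by
      rintro rfl
      have := hr' 0
      rw [zero_mul, zero_mul, add_zero] at this
      exact hab.elim (fun h => h this) (fun h => h rfl)
    have := finrank_diffSpan_le_one_of_eq hj (r := -a / b) fun i => by
      rw [eq_div_iff hb]; linear_combination hr' i
    omega
  have hind : ∀ x y z : L, x • D (u 0) + y • D (u 1) + z • D (u 2) = 0 → x = 0 ∧ y = 0 := by
    intro x y z hxyz
    obtain ⟨s, hs⟩ := exists_eq_smul_of_three_le_finrank (c' := ![x, y, z, 0]) h3 hrel
      (by simpa [Fin.sum_univ_four] using hxyz) hh0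
    have hs0 : s = 0 := by
      have := congrFun hs 3
      simpa [(hj 3).h_ne_zero] using this
    rw [hs0, zero_smul] at hs
    exact ⟨congrFun hs 0, congrFun hs 1⟩
  have hR12 : R 1 - R 2 ≠ 0 := fun h0 => by
    have h5 := congrArg D (sub_eq_zero.mp h0)
    rw [(hj 1).map_R, (hj 2).map_R] at h5
    exact mul_ne_zero (hj 1).R_ne_zero (hj 1).h_ne_zero
      (hind 0 (R 1 * h 1) (-(R 2 * h 2)) (by rw [h5]; module)).2
  have hnm : D (u 0) ∉ Submodule.span L {D (u 1), D (u 2)} := fun hm => by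
    obtain ⟨x, y, hxy⟩ := Submodule.mem_span_pair.mp hm
    exact one_ne_zero (hind 1 (-x) (-y) (by rw [← hxy]; module)).1
  obtain ⟨φ, hφ0, hφ⟩ := exists_dual_of_notMem hnm
  have hφ1 : φ (D (u 1)) = 0 := hφ _ (Submodule.subset_span (by simp))
  have hφ2 : φ (D (u 2)) = 0 := hφ _ (Submodule.subset_span (by simp))
  have hcross : (h 0 - h 1) * (R 0 - R 2) = (h 0 - h 2) * (R 0 - R 1) := by
    refine mul_left_cancel₀ hr0 ?_
    linear_combination (-(R 0 - R 2) + (R 0 - R 1)) * hr' 0 + (R 0 - R 2) * hr' 1 -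
      (R 0 - R 1) * hr' 2
  have hg : g 0 * (R 1 - R 2) = h 1 - h 2 := by
    have h5 := congrArg (fun x => φ (D x)) hcross
    simp only [Derivation.leibniz, map_sub, (hj _).map_R, (hj _).map_h, map_add, map_smul,
      smul_eq_mul, hφ1, hφ2] at h5
    refine mul_left_cancel₀ (mul_ne_zero (mul_ne_zero (hj 0).R_ne_zero (hj 0).h_ne_zero) hφ0) ?_
    linear_combination h5
  have h5 := congrArg (fun x => φ (D x)) hg
  simp only [Derivation.leibniz, map_sub, (hj _).map_R, (hj _).map_h, (hj _).map_g, map_add,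
    map_smul, smul_eq_mul, hφ1, hφ2, mul_zero, sub_zero, zero_add] at h5
  exact mul_ne_zero hR12 (mul_ne_zero (hj 0).k_ne_zero hφ0) h5

end Configuration

/-- The relations between the values of two functions, `a` and `b`, at the sixteen vertices of two
pairs of four-cycles. The first index numbers the pair, the second the cycle, the third the vertex
of the cycle. -/
structure IsCyclePair {M : Type} [AddCommGroup M] (a b : Fin 2 → Fin 2 → Fin 4 → M) : Prop where
  left_front : ∀ c, a c 0 0 - a c 0 1 = a c 1 0 - a c 1 1
  left_back : ∀ c, a c 0 2 - a c 0 3 = a c 1 2 - a c 1 3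
  right_front : ∀ c, b c 0 0 - b c 0 3 = b c 1 0 - b c 1 3
  right_back : ∀ c, b c 0 1 - b c 0 2 = b c 1 1 - b c 1 2
  left_alt : a 0 1 0 - a 0 1 1 + a 0 1 2 - a 0 1 3 = a 1 1 0 - a 1 1 1 + a 1 1 2 - a 1 1 3
  right_alt : b 0 1 0 - b 0 1 1 + b 0 1 2 - b 0 1 3 = b 1 1 0 - b 1 1 1 + b 1 1 2 - b 1 1 3

theorem finrank_add_finrank_le_of_le_inf {L V : Type} [Field L] [AddCommGroup V] [Module L V]
    {A B T : Submodule L V} [FiniteDimensional L A] [FiniteDimensional L B] (hA : T ≤ A)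
    (hB : T ≤ B) : Module.finrank L ↥(A ⊔ B) + Module.finrank L T ≤
      Module.finrank L A + Module.finrank L B := by
  rw [← Submodule.finrank_sup_add_finrank_inf_eq A B]
  have : FiniteDimensional L ↥(A ⊓ B) := Submodule.finiteDimensional_inf_left A B
  exact Nat.add_le_add_left (Submodule.finrank_mono (le_inf hA hB)) _

section CyclePair

variable {L V : Type} [Field L] [Algebra ℚ L] [AddCommGroup V] [Module L V] [Module ℚ V]
  {D : Derivation ℚ L V}

theorem finrank_diffSpan_sup_diffSpan_le {u v R h g k u' v' R' h' g' k' : Fin 4 → L}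
    (hj : ∀ i, IsJet D (u i) (v i) (R i) (h i) (g i) (k i))
    (hj' : ∀ i, IsJet D (u' i) (v' i) (R' i) (h' i) (g' i) (k' i))
    (hedge : edgeSpan D u v = edgeSpan D u' v') (halt : altSpan D u v = altSpan D u' v') :
    (1 ≤ Module.finrank L (altSpan D u v) →
      Module.finrank L ↥(diffSpan D u ⊔ diffSpan D u') ≤ Module.finrank L (altSpan D u v) + 2) ∧
    (Module.finrank L (altSpan D u v) = 0 →
      Module.finrank L ↥(diffSpan D u ⊔ diffSpan D u') ≤ 3) := by
  have h1 := finrank_diffSpan_le_finrank_edgeSpan_add_one hj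
  have h1' := finrank_diffSpan_le_finrank_edgeSpan_add_one hj'
  have h2 := finrank_diffSpan_le_finrank_altSpan_add_two hj
  have h2' := finrank_diffSpan_le_finrank_altSpan_add_two hj'
  have h3 := not_finrank_eq_of_altSpan_ne_zero hj
  have h3' := not_finrank_eq_of_altSpan_ne_zero hj'
  have h4 := Submodule.finrank_mono (altSpan_le_edgeSpan D u v)
  have h5 := finrank_add_finrank_le_of_le_inf (edgeSpan_le_diffSpan hj)
    (hedge.le.trans (edgeSpan_le_diffSpan hj'))
  rw [← hedge] at h1' h3'
  rw [← halt] at h2' h3'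
  have h6 := Submodule.finrank_mono (edgeSpan_le_diffSpan hj)
  omega

theorem finrank_iSup_diffSpan_le {u v R h g k : Fin 2 → Fin 2 → Fin 4 → L}
    (huv : IsCyclePair u v)
    (hj : ∀ c s i, IsJet D (u c s i) (v c s i) (R c s i) (h c s i) (g c s i) (k c s i)) :
    Module.finrank L ↥((diffSpan D (u 0 0) ⊔ diffSpan D (u 0 1)) ⊔
      (diffSpan D (u 1 0) ⊔ diffSpan D (u 1 1))) ≤ 6 := by
  have hedge : ∀ c, edgeSpan D (u c 0) (v c 0) = edgeSpan D (u c 1) (v c 1) := fun c => by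
    rw [edgeSpan, edgeSpan, huv.left_front, huv.left_back, huv.right_front, huv.right_back]
  have halt : ∀ c, altSpan D (u c 0) (v c 0) = altSpan D (u c 1) (v c 1) := fun c => by
    rw [altSpan, altSpan,
      show u c 0 0 - u c 0 1 + u c 0 2 - u c 0 3 = u c 1 0 - u c 1 1 + u c 1 2 - u c 1 3 by
        linear_combination huv.left_front c + huv.left_back c,
      show v c 0 0 - v c 0 1 + v c 0 2 - v c 0 3 = v c 1 0 - v c 1 1 + v c 1 2 - v c 1 3 by
        linear_combination huv.right_front c - huv.right_back c]
  have halt' : altSpan D (u 0 1) (v 0 1) = altSpan D (u 1 1) (v 1 1) := by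
    rw [altSpan, altSpan, huv.left_alt, huv.right_alt]
  have h0 := finrank_diffSpan_sup_diffSpan_le (hj 0 0) (hj 0 1) (hedge 0) (halt 0)
  have h1 := finrank_diffSpan_sup_diffSpan_le (hj 1 0) (hj 1 1) (hedge 1) (halt 1)
  have hle : ∀ c, altSpan D (u c 1) (v c 1) ≤ diffSpan D (u c 0) ⊔ diffSpan D (u c 1) := fun c =>
    ((altSpan_le_edgeSpan D _ _).trans (edgeSpan_le_diffSpan (hj c 1))).trans le_sup_right
  have h2 := finrank_add_finrank_le_of_le_inf (hle 0) (halt'.le.trans (hle 1))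
  rw [halt 0] at h0
  rw [halt 1, ← halt'] at h1
  have h3 : Module.finrank L (altSpan D (u 0 1) (v 0 1)) ≤ 2 :=
    (finrank_range_le_card (R := L) ![D (u 0 1 0 - u 0 1 1 + u 0 1 2 - u 0 1 3),
      D (v 0 1 0 - v 0 1 1 + v 0 1 2 - v 0 1 3)]).trans_eq (Fintype.card_fin 2)
  omega

end CyclePair

theorem not_algebraicIndependent_of_isCyclePair {P Q : RatFunc ℚ}
    (hPQ : LinearIndependent ℚ ![P, Q, (1 : RatFunc ℚ)]) {L : Type} [Field L] [Algebra ℚ L]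
    {y : Fin 2 × Fin 2 × Fin 4 → L}
    (hy : IsCyclePair (fun c s i => evalIn P (y (c, s, i))) fun c s i => evalIn Q (y (c, s, i)))
    (e : Fin 7 → Fin 2 × Fin 2 × Fin 4) : ¬ AlgebraicIndependent ℚ (y ∘ e) := by
  intro hind
  have hli := linearIndependent_D_of_algebraicIndependent hind
  let D := KaehlerDifferential.D ℚ L
  choose a R h g k ha hD hj using fun c s i => exists_isJet hPQ D (y (c, s, i))
  have h6 := finrank_iSup_diffSpan_le hy hj
  set W := (diffSpan D (fun i => evalIn P (y (0, 0, i))) ⊔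
    diffSpan D (fun i => evalIn P (y (0, 1, i)))) ⊔
      (diffSpan D (fun i => evalIn P (y (1, 0, i))) ⊔
        diffSpan D (fun i => evalIn P (y (1, 1, i))))
  have hW : ∀ c s, diffSpan D (fun i => evalIn P (y (c, s, i))) ≤ W := by
    intro c s
    fin_cases c <;> fin_cases s
    · exact le_sup_left.trans le_sup_left
    · exact le_sup_right.trans le_sup_left
    · exact le_sup_left.trans le_sup_right
    · exact le_sup_right.trans le_sup_right
  have hmem : ∀ j, D (y j) ∈ W := fun ⟨c, s, i⟩ =>
    (Submodule.smul_mem_iff _ (ha c s i)).mp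
      (hD c s i ▸ hW c s (Submodule.subset_span ⟨i, rfl⟩))
  have h7 : 7 ≤ Module.finrank L W := by
    have hle : Submodule.span L (Set.range fun i => D ((y ∘ e) i)) ≤ W := by
      refine Submodule.span_le.mpr ?_
      rintro _ ⟨i, rfl⟩
      exact hmem (e i)
    have := Submodule.finrank_mono hle
    rwa [finrank_span_eq_card hli, Fintype.card_fin] at this
  omega

theorem polyRed_coeff (p : ℕ) (f : ℚ[X]) (n : ℕ) :
    (polyRed p f).coeff n = ratRed p (f.coeff n) := by
  rw [polyRed, Polynomial.sum_def, Polynomial.finsetSum_coeff]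
  simp only [Polynomial.coeff_C_mul_X_pow]
  rw [Finset.sum_ite_eq]
  split_ifs with h
  · rfl
  · rw [Polynomial.notMem_support_iff.mp h]
    simp [ratRed]

theorem mul_ratRed_eq_intCast {p : ℕ} [Fact p.Prime] {c z : ℤ} (hc : (c : ZMod p) ≠ 0) {q : ℚ}
    (hq : (z : ℚ) = c * q) : (c : ZMod p) * ratRed p q = z := by
  have h1 : z * q.den = c * q.num := by
    have h2 : (z : ℚ) * q.den = c * q.num := by
      rw [hq, mul_assoc, Rat.mul_den_eq_num]
    exact_mod_cast h2
  have h3 : (z : ZMod p) * q.den = c * q.num := by exact_mod_cast congrArg (Int.cast (R := ZMod p)) h1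
  have hden : (q.den : ZMod p) ≠ 0 := fun h0 => by
    rw [h0, mul_zero] at h3
    have hnum : (q.num : ZMod p) = 0 := (mul_eq_zero.mp h3.symm).resolve_left hc
    rw [ZMod.intCast_zmod_eq_zero_iff_dvd] at hnum
    rw [ZMod.natCast_eq_zero_iff] at h0
    exact (Nat.Prime.one_lt Fact.out).ne'
      (Nat.dvd_one.mp (q.reduced ▸ Nat.dvd_gcd (Int.natCast_dvd.mp hnum) h0))
  rw [ratRed, ← mul_assoc, ← h3, mul_assoc, mul_inv_cancel₀ hden, mul_one]

theorem exists_map_eq_C_mul_polyRed (f : ℚ[X]) : ∃ (c : ℤ) (F : ℤ[X]), c ≠ 0 ∧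
    F.map (Int.castRingHom ℚ) = C (c : ℚ) * f ∧ ∀ (p : ℕ) [Fact p.Prime], (c : ZMod p) ≠ 0 →
      F.map (Int.castRingHom (ZMod p)) = C (c : ZMod p) * polyRed p f := by
  obtain ⟨b, hb, hF⟩ := IsLocalization.integerNormalization_spec (nonZeroDivisors ℤ) f
  set F := IsLocalization.integerNormalization (nonZeroDivisors ℤ) f
  have hF' : ∀ n, (F.coeff n : ℚ) = b * f.coeff n := fun n => by
    simpa [zsmul_eq_mul] using congrArg (fun g => Polynomial.coeff g n) hF
  refine ⟨b, F, nonZeroDivisors.ne_zero hb, ?_, fun p _ hp => ?_⟩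
  · ext n
    simp [hF']
  · ext n
    rw [Polynomial.coeff_C_mul, polyRed_coeff, mul_ratRed_eq_intCast hp (hF' n)]
    simp

theorem intCast_zmod_ne_zero_of_natAbs_lt {c : ℤ} (hc : c ≠ 0) {p : ℕ} (hp : c.natAbs < p) :
    (c : ZMod p) ≠ 0 := fun h => by
  rw [ZMod.intCast_zmod_eq_zero_iff_dvd, Int.natCast_dvd] at h
  exact absurd (Nat.le_of_dvd (Int.natAbs_pos.mpr hc) h) (by omega)

theorem exists_int_fraction (P : RatFunc ℚ) : ∃ (A B : ℤ[X]) (p₀ : ℕ),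
    (∀ (p : ℕ) [Fact p.Prime], p₀ < p → ∀ y : ZMod p,
      (¬ IsPole p P y → aeval y B ≠ 0) ∧ evalRed p P y = aeval y A / aeval y B) ∧
    ∀ (L : Type) [Field L] [Algebra ℚ L] (y : L), evalIn P y = aeval y A / aeval y B := by
  obtain ⟨a, A, ha, hA, hAp⟩ := exists_map_eq_C_mul_polyRed P.num
  obtain ⟨b, B, hb, hB, hBp⟩ := exists_map_eq_C_mul_polyRed P.denom
  refine ⟨C b * A, C a * B, max a.natAbs b.natAbs, fun p _ hp y => ?_, fun L _ _ y => ?_⟩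
  · have ha' := intCast_zmod_ne_zero_of_natAbs_lt ha ((le_max_left _ _).trans_lt hp)
    have hb' := intCast_zmod_ne_zero_of_natAbs_lt hb ((le_max_right _ _).trans_lt hp)
    have h1 : aeval y A = a * (polyRed p P.num).eval y := by
      rw [aeval_def, ← eval_map, algebraMap_int_eq, hAp p ha']; simp
    have h2 : aeval y B = b * (polyRed p P.denom).eval y := by
      rw [aeval_def, ← eval_map, algebraMap_int_eq, hBp p hb']; simp
    simp only [map_mul, map_intCast, h1, h2, IsPole, evalRed, eq_intCast]
    refine ⟨fun h => mul_ne_zero ha' (mul_ne_zero hb' h), ?_⟩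
    by_cases h0 : (polyRed p P.denom).eval y = 0
    · simp [h0]
    · field_simp
  · have : CharZero L := algebraRat.charZero L
    have ha' : (a : L) ≠ 0 := Int.cast_ne_zero.mpr ha
    have hb' : (b : L) ≠ 0 := Int.cast_ne_zero.mpr hb
    have h1 : aeval y A = a * aeval y P.num := by
      rw [← aeval_map_algebraMap ℚ, algebraMap_int_eq, hA]
      simp
    have h2 : aeval y B = b * aeval y P.denom := by
      rw [← aeval_map_algebraMap ℚ, algebraMap_int_eq, hB]
      simp
    simp only [map_mul, map_intCast, h1, h2, evalIn, eq_intCast]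
    by_cases h0 : aeval y P.denom = 0
    · simp [h0]
    · field_simp

/-- The numerator of `∑ i, s i * A(X i) / B(X i)` over the common denominator `∏ i, B(X i)`. -/
def clearedForm {σ : Type} [Fintype σ] [DecidableEq σ] (A B : ℤ[X]) (s : σ → ℤ) :
    MvPolynomial σ ℤ :=
  ∑ i, s i • (aeval (MvPolynomial.X i : MvPolynomial σ ℤ) A *
    ∏ j ∈ Finset.univ.erase i, aeval (MvPolynomial.X j : MvPolynomial σ ℤ) B)

theorem aeval_aeval_X {σ K : Type} [Field K] (A : ℤ[X]) (y : σ → K) (i : σ) :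
    MvPolynomial.aeval y (aeval (MvPolynomial.X i : MvPolynomial σ ℤ) A) = aeval (y i) A := by
  rw [← aeval_algHom_apply, MvPolynomial.aeval_X]

theorem aeval_clearedForm_eq_zero_iff {σ K : Type} [Fintype σ] [DecidableEq σ] [Field K]
    (A B : ℤ[X]) (s : σ → ℤ) {y : σ → K} (hB : ∀ i, aeval (y i) B ≠ 0) :
    MvPolynomial.aeval y (clearedForm A B s) = 0 ↔
      ∑ i, s i • (aeval (y i) A / aeval (y i) B) = 0 := by
  have h : MvPolynomial.aeval y (clearedForm A B s) =
      (∏ j, aeval (y j) B) * ∑ i, s i • (aeval (y i) A / aeval (y i) B) := by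
    rw [clearedForm, map_sum, Finset.mul_sum]
    refine Finset.sum_congr rfl fun i _ => ?_
    rw [map_zsmul, map_mul, map_prod, aeval_aeval_X, mul_smul_comm,
      ← Finset.mul_prod_erase _ _ (Finset.mem_univ i)]
    simp only [aeval_aeval_X]
    congr 1
    field_simp [hB i]
  rw [h, mul_eq_zero, or_iff_right (Finset.prod_ne_zero_iff.mpr fun i _ => hB i)]

/-- Coefficients of the linear relations for the first function in `IsCyclePair`. -/
def leftForm : Fin 5 → Fin 2 × Fin 2 × Fin 4 → ℤ :=
  ![Pi.single (0, 0, 0) 1 - Pi.single (0, 0, 1) 1 - (Pi.single (0, 1, 0) 1 - Pi.single (0, 1, 1) 1),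
    Pi.single (1, 0, 0) 1 - Pi.single (1, 0, 1) 1 - (Pi.single (1, 1, 0) 1 - Pi.single (1, 1, 1) 1),
    Pi.single (0, 0, 2) 1 - Pi.single (0, 0, 3) 1 - (Pi.single (0, 1, 2) 1 - Pi.single (0, 1, 3) 1),
    Pi.single (1, 0, 2) 1 - Pi.single (1, 0, 3) 1 - (Pi.single (1, 1, 2) 1 - Pi.single (1, 1, 3) 1),
    Pi.single (0, 1, 0) 1 - Pi.single (0, 1, 1) 1 + Pi.single (0, 1, 2) 1 - Pi.single (0, 1, 3) 1 -
      (Pi.single (1, 1, 0) 1 - Pi.single (1, 1, 1) 1 + Pi.single (1, 1, 2) 1 -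
        Pi.single (1, 1, 3) 1)]

/-- Coefficients of the linear relations for the second function in `IsCyclePair`. -/
def rightForm : Fin 5 → Fin 2 × Fin 2 × Fin 4 → ℤ :=
  ![Pi.single (0, 0, 0) 1 - Pi.single (0, 0, 3) 1 - (Pi.single (0, 1, 0) 1 - Pi.single (0, 1, 3) 1),
    Pi.single (1, 0, 0) 1 - Pi.single (1, 0, 3) 1 - (Pi.single (1, 1, 0) 1 - Pi.single (1, 1, 3) 1),
    Pi.single (0, 0, 1) 1 - Pi.single (0, 0, 2) 1 - (Pi.single (0, 1, 1) 1 - Pi.single (0, 1, 2) 1),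
    Pi.single (1, 0, 1) 1 - Pi.single (1, 0, 2) 1 - (Pi.single (1, 1, 1) 1 - Pi.single (1, 1, 2) 1),
    Pi.single (0, 1, 0) 1 - Pi.single (0, 1, 1) 1 + Pi.single (0, 1, 2) 1 - Pi.single (0, 1, 3) 1 -
      (Pi.single (1, 1, 0) 1 - Pi.single (1, 1, 1) 1 + Pi.single (1, 1, 2) 1 -
        Pi.single (1, 1, 3) 1)]

theorem sum_single_smul {σ M : Type} [Fintype σ] [DecidableEq σ] [AddCommGroup M] (j : σ)
    (a : σ → M) : ∑ i, (Pi.single j (1 : ℤ) : σ → ℤ) i • a i = a j := by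
  simp [Pi.single_apply, ite_smul]

theorem isCyclePair_iff {M : Type} [AddCommGroup M] (a b : Fin 2 × Fin 2 × Fin 4 → M) :
    IsCyclePair (fun c s i => a (c, s, i)) (fun c s i => b (c, s, i)) ↔
      (∀ t, ∑ i, leftForm t i • a i = 0) ∧ ∀ t, ∑ i, rightForm t i • b i = 0 := by
  simp only [Fin.forall_fin_succ, Fin.forall_fin_zero, leftForm, rightForm,
    Matrix.cons_val_zero, Matrix.cons_val_succ, Pi.sub_apply, Pi.add_apply, sub_smul, add_smul, Finset.sum_sub_distrib, Finset.sum_add_distrib,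
    sum_single_smul, sub_eq_zero]
  constructor
  · rintro ⟨h1, h2, h3, h4, h5, h6⟩
    exact ⟨⟨h1 0, h1 1, h2 0, h2 1, h5, trivial⟩, h3 0, h3 1, h4 0, h4 1, h6, trivial⟩
  · rintro ⟨⟨h1, h2, h3, h4, h5, -⟩, h1', h2', h3', h4', h5', -⟩
    refine ⟨fun c => ?_, fun c => ?_, fun c => ?_, fun c => ?_, h5, h5'⟩ <;>
      fin_cases c <;> assumption

theorem exists_card_cyclePair_le {P Q : RatFunc ℚ}
    (hPQ : LinearIndependent ℚ ![P, Q, (1 : RatFunc ℚ)]) :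
    ∃ N p₀ : ℕ, ∀ (p : ℕ) [Fact p.Prime], p₀ < p →
      ∀ X : Finset (Fin 2 × Fin 2 × Fin 4 → ZMod p),
        (∀ y ∈ X, (∀ i, ¬ IsPole p P (y i)) ∧ (∀ i, ¬ IsPole p Q (y i)) ∧
          IsCyclePair (fun c s i => evalRed p P (y (c, s, i)))
            fun c s i => evalRed p Q (y (c, s, i))) →
        X.card ≤ N * p ^ 6 := by
  obtain ⟨A, B, p₁, hp₁, hPL⟩ := exists_int_fraction P
  obtain ⟨A', B', p₂, hp₂, hQL⟩ := exists_int_fraction Q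
  have hg : ∀ (K : Type) [Field K] (y : Fin 2 × Fin 2 × Fin 4 → K),
      MvPolynomial.aeval y (∏ j, aeval (MvPolynomial.X j : MvPolynomial _ ℤ) B *
        aeval (MvPolynomial.X j : MvPolynomial _ ℤ) B') ≠ 0 ↔
      ∀ j, aeval (y j) B ≠ 0 ∧ aeval (y j) B' ≠ 0 := fun K _ y => by
    simp only [map_prod, map_mul, aeval_aeval_X, Finset.prod_ne_zero_iff, mul_ne_zero_iff,
      Finset.mem_univ, true_imp_iff]
  obtain ⟨N, p₃, hN⟩ := exists_card_le_of_generic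
    (Set.range (fun t => clearedForm A B (leftForm t)) ∪
      Set.range fun t => clearedForm A' B' (rightForm t))
    (∏ j, aeval (MvPolynomial.X j : MvPolynomial _ ℤ) B *
      aeval (MvPolynomial.X j : MvPolynomial _ ℤ) B') 6 (by
    intro L _ _ y hE hgy e _
    have hB := (hg L y).mp hgy
    refine not_algebraicIndependent_of_isCyclePair hPQ ?_ e
    refine (isCyclePair_iff (fun j => evalIn P (y j)) fun j => evalIn Q (y j)).mpr
      ⟨fun t => ?_, fun t => ?_⟩
    · simp only [hPL]
      exact (aeval_clearedForm_eq_zero_iff _ _ _ fun i => (hB i).1).mp (hE _ (.inl ⟨t, rfl⟩))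
    · simp only [hQL]
      exact (aeval_clearedForm_eq_zero_iff _ _ _ fun i => (hB i).2).mp (hE _ (.inr ⟨t, rfl⟩)))
  refine ⟨N, max p₃ (max p₁ p₂), fun p _ hp X hX => ?_⟩
  simp only [max_lt_iff] at hp
  refine hN p hp.1 X fun y hy => ?_
  obtain ⟨hP, hQ, hcyc⟩ := hX y hy
  have hB : ∀ j, aeval (y j) B ≠ 0 ∧ aeval (y j) B' ≠ 0 := fun j =>
    ⟨(hp₁ p hp.2.1 _).1 (hP j), (hp₂ p hp.2.2 _).1 (hQ j)⟩
  refine ⟨?_, (hg _ y).mpr hB⟩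
  obtain ⟨hl, hr⟩ := (isCyclePair_iff (fun j => evalRed p P (y j))
    fun j => evalRed p Q (y j)).mp hcyc
  rintro _ (⟨t, rfl⟩ | ⟨t, rfl⟩)
  · refine (aeval_clearedForm_eq_zero_iff _ _ _ fun i => (hB i).1).mpr ?_
    simpa only [(hp₁ p hp.2.1 _).2] using hl t
  · refine (aeval_clearedForm_eq_zero_iff _ _ _ fun i => (hB i).2).mpr ?_
    simpa only [(hp₂ p hp.2.2 _).2] using hr t

theorem card_filter_eq_sum_mul {S Λ : Type} [DecidableEq Λ] (s : Finset S) (I : Finset Λ)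
    (f g : S → Λ) (hf : ∀ x ∈ s, f x ∈ I) :
    ((s ×ˢ s).filter fun x => f x.1 = g x.2).card =
      ∑ l ∈ I, (s.filter fun x => f x = l).card * (s.filter fun x => g x = l).card := by
  rw [Finset.card_eq_sum_card_fiberwise (f := fun x => f x.1) (t := I) fun x hx =>
    hf _ (Finset.mem_product.mp (Finset.mem_filter.mp hx).1).1]
  refine Finset.sum_congr rfl fun l _ => ?_
  rw [← Finset.card_product]
  congr 1
  ext ⟨x, x'⟩
  simp only [Finset.mem_filter, Finset.mem_product]
  constructor
  · rintro ⟨⟨⟨h1, h2⟩, h3⟩, h4⟩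
    exact ⟨⟨h1, h4⟩, h2, h3.symm.trans h4⟩
  · rintro ⟨⟨h1, h4⟩, h2, h3⟩
    exact ⟨⟨⟨h1, h2⟩, h4.trans h3.symm⟩, h4⟩

theorem two_mul_card_filter_eq_le {S Λ : Type} [DecidableEq Λ] (s : Finset S) (f g : S → Λ) :
    2 * ((s ×ˢ s).filter fun x => f x.1 = g x.2).card ≤
      ((s ×ˢ s).filter fun x => f x.1 = f x.2).card +
        ((s ×ˢ s).filter fun x => g x.1 = g x.2).card := by
  have hf : ∀ x ∈ s, f x ∈ s.image f ∪ s.image g := fun x hx =>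
    Finset.mem_union_left _ (Finset.mem_image_of_mem f hx)
  have hg : ∀ x ∈ s, g x ∈ s.image f ∪ s.image g := fun x hx =>
    Finset.mem_union_right _ (Finset.mem_image_of_mem g hx)
  rw [card_filter_eq_sum_mul s _ f g hf, card_filter_eq_sum_mul s _ f f hf,
    card_filter_eq_sum_mul s _ g g hg, Finset.mul_sum, ← Finset.sum_add_distrib]
  refine Finset.sum_le_sum fun l _ => ?_
  nlinarith [two_mul_le_add_sq (s.filter fun x => f x = l).card (s.filter fun x => g x = l).card]

section Energy

variable {T M : Type} [AddCommGroup M]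

/-- The relations of the Roth variety, for arbitrary functions `a`, `b`. -/
def IsRothTuple (a b : T → M) (y : Fin 16 → T) : Prop :=
  a (y 0) - a (y 2) - a (y 8) + a (y 10) = 0 ∧
  a (y 1) - a (y 3) - a (y 9) + a (y 11) = 0 ∧
  a (y 4) - a (y 6) - a (y 12) + a (y 14) = 0 ∧
  a (y 5) - a (y 7) - a (y 13) + a (y 15) = 0 ∧
  b (y 0) - b (y 1) - b (y 8) + b (y 9) = 0 ∧
  b (y 2) - b (y 6) - b (y 10) + b (y 14) = 0 ∧
  b (y 3) - b (y 7) - b (y 11) + b (y 15) = 0 ∧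
  b (y 4) - b (y 5) - b (y 12) + b (y 13) = 0 ∧
  a (y 8) - a (y 9) - a (y 10) + a (y 11) - a (y 12) + a (y 13) + a (y 14) - a (y 15) = 0 ∧
  b (y 8) - b (y 9) - b (y 10) + b (y 11) - b (y 12) + b (y 13) + b (y 14) - b (y 15) = 0

/-- A pair of edges, between `(x 0, x 1)` and `(x 2, x 3)` and between `(x 4, x 5)` and
`(x 6, x 7)`, along which the difference of values of `b` is constant. -/
def IsEdgePair (b : T → M) (x : Fin 8 → T) : Prop :=
  b (x 0) - b (x 1) = b (x 2) - b (x 3) ∧ b (x 4) - b (x 5) = b (x 6) - b (x 7)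

/-- The data of a pair of edges seen by the rest of the cycle of length eight. -/
def edgePairLabel (a b : T → M) (x : Fin 8 → T) : Fin 6 → M :=
  ![a (x 0) - a (x 1), a (x 2) - a (x 3), a (x 4) - a (x 5), a (x 6) - a (x 7),
    a (x 1) - a (x 3) + (a (x 5) - a (x 7)), b (x 1) - b (x 3) + (b (x 5) - b (x 7))]

/-- The label of a pair of edges that complements a pair of edges with label `l`. -/
def complementLabel (l : Fin 6 → M) : Fin 6 → M :=
  ![l 1, l 2, l 3, l 0, -l 4, -l 5]

theorem complementLabel_injective : Function.Injective (complementLabel (M := M)) := by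
  intro l l' h
  have := congrFun h
  simp only [complementLabel, Fin.forall_fin_succ, Matrix.cons_val_zero, Matrix.cons_val_succ,
    neg_inj] at this
  obtain ⟨h1, h2, h3, h0, h4, h5, -⟩ := this
  funext i
  fin_cases i <;> assumption

theorem isEdgePair_of_isRothTuple {a b : T → M} {y : Fin 16 → T} (hy : IsRothTuple a b y) :
    IsEdgePair b ![y 2, y 10, y 6, y 14, y 7, y 15, y 3, y 11] ∧
      IsEdgePair b ![y 4, y 12, y 5, y 13, y 1, y 9, y 0, y 8] ∧
      complementLabel (edgePairLabel a b ![y 2, y 10, y 6, y 14, y 7, y 15, y 3, y 11]) =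
        edgePairLabel a b ![y 4, y 12, y 5, y 13, y 1, y 9, y 0, y 8] := by
  obtain ⟨h1, h2, h3, h4, h5, h6, h7, h8, h9, h10⟩ := hy
  simp only [IsEdgePair, edgePairLabel, complementLabel, Matrix.cons_val]
  refine ⟨⟨?_, ?_⟩, ⟨?_, ?_⟩, ?_⟩
  · rw [← sub_eq_zero, ← h6]; abel
  · rw [← sub_eq_zero, ← neg_eq_zero, ← h7]; abel
  · rw [← sub_eq_zero, ← h8]; abel
  · rw [← sub_eq_zero, ← neg_eq_zero, ← h5]; abel
  · funext i
    fin_cases i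
    · change _ - _ = _ - _
      rw [← sub_eq_zero, ← neg_eq_zero, ← h3]; abel
    · change _ - _ = _ - _
      rw [← sub_eq_zero, ← neg_eq_zero, ← h4]; abel
    · change _ - _ = _ - _
      rw [← sub_eq_zero, ← neg_eq_zero, ← h2]; abel
    · change _ - _ = _ - _
      rw [← sub_eq_zero, ← neg_eq_zero, ← h1]; abel
    · change -(_ - _ + (_ - _)) = _ - _ + (_ - _)
      rw [← sub_eq_zero, ← h9]; abel
    · change -(_ - _ + (_ - _)) = _ - _ + (_ - _)
      rw [← sub_eq_zero, ← h10]; abel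

/-- The two pairs of four-cycles formed by two pairs of edges with the same label. -/
def cyclePairOf (x x' : Fin 8 → T) : Fin 2 × Fin 2 × Fin 4 → T := fun j =>
  ![![![x 0, x' 0, x' 2, x 2], ![x 1, x' 1, x' 3, x 3]],
    ![![x' 4, x 4, x 6, x' 6], ![x' 5, x 5, x 7, x' 7]]] j.1 j.2.1 j.2.2

theorem cyclePairOf_injective {x x' w w' : Fin 8 → T} (h : cyclePairOf x x' = cyclePairOf w w') :
    x = w ∧ x' = w' := by
  have := fun c s i => congrFun h (c, s, i)
  simp only [cyclePairOf, Fin.forall_fin_succ, Matrix.cons_val_zero, Matrix.cons_val_succ] at this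
  constructor <;> funext i <;> fin_cases i <;> tauto

theorem isCyclePair_cyclePairOf {a b : T → M} {x x' : Fin 8 → T} (hx : IsEdgePair b x)
    (hx' : IsEdgePair b x') (h : edgePairLabel a b x = edgePairLabel a b x') :
    IsCyclePair (fun c s i => a (cyclePairOf x x' (c, s, i)))
      fun c s i => b (cyclePairOf x x' (c, s, i)) := by
  have h' := congrFun h
  simp only [edgePairLabel, Fin.forall_fin_succ, Matrix.cons_val_zero, Matrix.cons_val_succ] at h'
  obtain ⟨h0, h1, h2, h3, h4, h5, -⟩ := h'
  obtain ⟨h6, h7⟩ := hx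
  obtain ⟨h8, h9⟩ := hx'
  have swap : ∀ {p q r s : M}, p - q = r - s → p - r = q - s := fun {p q r s} h => by
    rw [← sub_eq_zero] at h ⊢; rw [← h]; abel
  refine ⟨fun c => ?_, fun c => ?_, fun c => ?_, fun c => ?_, ?_, ?_⟩
  · fin_cases c
    · exact swap h0
    · exact swap h2.symm
  · fin_cases c
    · exact swap h1.symm
    · exact swap h3
  · fin_cases c
    · exact swap h6
    · exact swap h9
  · fin_cases c
    · exact swap h8
    · exact swap h7
  · change a (x 1) - a (x' 1) + a (x' 3) - a (x 3) = a (x' 5) - a (x 5) + a (x 7) - a (x' 7)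
    rw [← sub_eq_zero] at h4 ⊢; rw [← h4]; abel
  · change b (x 1) - b (x' 1) + b (x' 3) - b (x 3) = b (x' 5) - b (x 5) + b (x 7) - b (x' 7)
    rw [← sub_eq_zero] at h5 ⊢; rw [← h5]; abel

open Classical in
theorem card_isRothTuple_le [Fintype T] (a b : T → M) :
    (Finset.univ.filter fun y => IsRothTuple a b y).card ≤
      (Finset.univ.filter fun y : Fin 2 × Fin 2 × Fin 4 → T =>
        IsCyclePair (fun c s i => a (y (c, s, i))) fun c s i => b (y (c, s, i))).card := by
  let s : Finset (Fin 8 → T) := Finset.univ.filter fun x => IsEdgePair b x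
  let f := edgePairLabel (M := M) a b
  have h1 : (Finset.univ.filter fun y => IsRothTuple a b y).card ≤
      ((s ×ˢ s).filter fun x => complementLabel (f x.1) = f x.2).card := by
    refine Finset.card_le_card_of_injOn (fun y => (![y 2, y 10, y 6, y 14, y 7, y 15, y 3, y 11],
      ![y 4, y 12, y 5, y 13, y 1, y 9, y 0, y 8])) (fun y hy => ?_) fun y _ y' _ h => ?_
    · obtain ⟨h1, h2, h3⟩ := isEdgePair_of_isRothTuple (Finset.mem_filter.mp hy).2
      simp only [Finset.coe_filter, Finset.mem_product, Set.mem_ofPred_eq]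
      exact ⟨⟨Finset.mem_filter.mpr ⟨Finset.mem_univ _, h1⟩,
        Finset.mem_filter.mpr ⟨Finset.mem_univ _, h2⟩⟩, h3⟩
    · obtain ⟨h1, h2⟩ := Prod.mk.inj h
      have h1 := congrFun h1
      have h2 := congrFun h2
      simp only [Fin.forall_fin_succ, Matrix.cons_val_zero, Matrix.cons_val_succ] at h1 h2
      funext i
      fin_cases i <;> tauto
  have h2 : ((s ×ˢ s).filter fun x => f x.1 = f x.2).card ≤
      (Finset.univ.filter fun y : Fin 2 × Fin 2 × Fin 4 → T =>
        IsCyclePair (fun c s i => a (y (c, s, i))) fun c s i => b (y (c, s, i))).card := by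
    refine Finset.card_le_card_of_injOn (fun x => cyclePairOf x.1 x.2) (fun x hx => ?_)
      fun x _ x' _ h => Prod.ext_iff.mpr (cyclePairOf_injective h)
    obtain ⟨hx, hf⟩ := Finset.mem_filter.mp hx
    obtain ⟨hx1, hx2⟩ := Finset.mem_product.mp hx
    exact Finset.mem_filter.mpr ⟨Finset.mem_univ _, isCyclePair_cyclePairOf
      (Finset.mem_filter.mp hx1).2 (Finset.mem_filter.mp hx2).2 hf⟩
  have h3 := two_mul_card_filter_eq_le s (fun x => complementLabel (f x)) f
  simp only [complementLabel_injective.eq_iff] at h3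
  omega

end Energy

theorem rothCard_le_pow (P Q : RatFunc ℚ) (p : ℕ) [Fact p.Prime] : rothCard p P Q ≤ p ^ 16 := by
  refine (Nat.card_le_card_of_injective _ Subtype.val_injective).trans_eq ?_
  rw [Nat.card_eq_fintype_card, Fintype.card_fun, ZMod.card, Fintype.card_fin]

open Classical in
theorem rothCard_le_card (P Q : RatFunc ℚ) (p : ℕ) [Fact p.Prime] : rothCard p P Q ≤
    (Finset.univ.filter fun y : Fin 2 × Fin 2 × Fin 4 → ZMod p =>
      (∀ i, ¬ IsPole p P (y i)) ∧ (∀ i, ¬ IsPole p Q (y i)) ∧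
        IsCyclePair (fun c s i => evalRed p P (y (c, s, i)))
          fun c s i => evalRed p Q (y (c, s, i))).card := by
  let T := {y : ZMod p // ¬ IsPole p P y ∧ ¬ IsPole p Q y}
  have h1 : rothCard p P Q ≤ (Finset.univ.filter fun y : Fin 16 → T =>
      IsRothTuple (fun y : T => evalRed p P y) (fun y : T => evalRed p Q y) y).card := by
    rw [rothCard, ← Fintype.card_subtype, ← Nat.card_eq_fintype_card]
    refine Nat.card_le_card_of_injective
      (fun y => ⟨fun i => ⟨y.1 i, y.2.1 i, y.2.2.1 i⟩, y.2.2.2⟩) fun y y' h => ?_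
    ext i
    exact congrArg Subtype.val (congrFun (congrArg Subtype.val h) i)
  refine h1.trans ((card_isRothTuple_le _ _).trans ?_)
  refine Finset.card_le_card_of_injOn (fun y i => (y i : ZMod p)) (fun y hy => ?_)
    fun y _ y' _ h => funext fun i => Subtype.ext (congrFun h i)
  exact Finset.mem_filter.mpr ⟨Finset.mem_univ _, fun i => (y i).2.1, fun i => (y i).2.2,
    (Finset.mem_filter.mp hy).2⟩

/-- **Theorem 4.2.** Point-counting estimate for the Roth variety: `|Y(F_p)| ≪ p⁶`. -/
theorem roth_point_count (P Q : RatFunc ℚ)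
    (hPQ : LinearIndependent ℚ ![P, Q, (1 : RatFunc ℚ)]) :
    ∃ C : ℝ, 0 < C ∧ ∀ (p : ℕ) [Fact p.Prime],
      Admissible p P → Admissible p Q →
      (rothCard p P Q : ℝ) ≤ C * (p : ℝ) ^ 6 := by
  classical
  obtain ⟨N, p₀, hN⟩ := exists_card_cyclePair_le hPQ
  refine ⟨((N + p₀ ^ 10 + 1 : ℕ) : ℝ), by positivity, fun p _ _ _ => ?_⟩
  suffices h : rothCard p P Q ≤ (N + p₀ ^ 10 + 1) * p ^ 6 by exact_mod_cast h
  rcases lt_or_ge p₀ p with hp | hp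
  · refine (rothCard_le_card P Q p).trans ((hN p hp _ fun y hy => ?_).trans
      (Nat.mul_le_mul_right _ (by omega)))
    exact (Finset.mem_filter.mp hy).2
  · calc rothCard p P Q ≤ p ^ 10 * p ^ 6 := (rothCard_le_pow P Q p).trans_eq (by ring)
      _ ≤ (N + p₀ ^ 10 + 1) * p ^ 6 :=
        Nat.mul_le_mul_right _ ((Nat.pow_le_pow_left hp 10).trans (by omega))

end RatCorners
end
end

section
/- Let P, Q ∈ ℚ(t) be such that P, Q and the constant function 1 are linearly independent over ℚ, and write R = P′/Q′ and S = R′/R = P″/P′ − Q″/Q′. Then the determinant D(y1,y4,y6) of the 3×3 matrix with rows (P′(y1), P′(y4), P′(y6)), (Q′(y1), Q′(y4), Q′(y6)), (S(y1), S(y4), S(y6)) is a nonzero element of the field ℚ(y1,y4,y6). -/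
open scoped BigOperators ComplexOrder
open Polynomial

noncomputable section

namespace RatCorners

variable (p : ℕ) [NeZero p]

theorem linearIndependent_iff_C_mul {f₀ f₁ f₂ : RatFunc ℚ} :
    LinearIndependent ℚ ![f₀, f₁, f₂] ↔ ∀ a b c : ℚ,
      RatFunc.C a * f₀ + RatFunc.C b * f₁ + RatFunc.C c * f₂ = 0 → a = 0 ∧ b = 0 ∧ c = 0 := by
  rw [Fintype.linearIndependent_iff]
  simp only [Fin.sum_univ_three, Matrix.cons_val, Algebra.smul_def, eq_ratCast, Fin.forall_fin_succ]
  refine ⟨fun h a b c habc => ?_, fun h g hg => ?_⟩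
  · simpa using h ![a, b, c] habc
  · simpa using h _ _ _ hg

theorem ratDeriv_div (a b : ℚ[X]) (hb : b ≠ 0) :
    ratDeriv (algebraMap ℚ[X] (RatFunc ℚ) a / algebraMap ℚ[X] (RatFunc ℚ) b) =
      algebraMap ℚ[X] (RatFunc ℚ) (derivative a * b - a * derivative b) /
        algebraMap ℚ[X] (RatFunc ℚ) (b ^ 2) := by
  generalize hf : algebraMap ℚ[X] (RatFunc ℚ) a / algebraMap ℚ[X] (RatFunc ℚ) b = f
  have hd := f.denom_ne_zero
  have key : f.num * b = a * f.denom := (RatFunc.num_mul_eq_mul_denom_iff hb).mpr hf.symm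
  have key' := congrArg derivative key
  simp only [derivative_mul] at key'
  rw [ratDeriv, div_eq_div_iff (RatFunc.algebraMap_ne_zero (pow_ne_zero 2 hd))
    (RatFunc.algebraMap_ne_zero (pow_ne_zero 2 hb)), ← map_mul, ← map_mul]
  refine congrArg _ ?_
  linear_combination (f.denom * b) * key' - (b * derivative f.denom + f.denom * derivative b) * key

theorem ratDeriv_C_mul_add_C_mul (a b : ℚ) (P Q : RatFunc ℚ) :
    ratDeriv (RatFunc.C a * P + RatFunc.C b * Q) =
      RatFunc.C a * ratDeriv P + RatFunc.C b * ratDeriv Q := by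
  have hP := P.denom_ne_zero
  have hQ := Q.denom_ne_zero
  have hP' := RatFunc.algebraMap_ne_zero hP
  have hQ' := RatFunc.algebraMap_ne_zero hQ
  have h : RatFunc.C a * P + RatFunc.C b * Q =
      algebraMap ℚ[X] (RatFunc ℚ) (C a * P.num * Q.denom + C b * Q.num * P.denom) /
        algebraMap ℚ[X] (RatFunc ℚ) (P.denom * Q.denom) := by
    conv_lhs => rw [← P.num_div_denom, ← Q.num_div_denom]
    simp only [map_add, map_mul, RatFunc.algebraMap_C]
    field_simp
  rw [h, ratDeriv_div _ _ (mul_ne_zero hP hQ), ratDeriv, ratDeriv]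
  simp only [derivative_mul, derivative_C, map_add, map_mul, map_sub, map_pow,
    map_zero, RatFunc.algebraMap_C]
  field_simp
  ring

theorem eq_C_of_ratDeriv_eq_zero {W : RatFunc ℚ} (h : ratDeriv W = 0) :
    ∃ c : ℚ, W = RatFunc.C c := by
  have hd := W.denom_ne_zero
  have h0 : derivative W.num * W.denom - W.num * derivative W.denom = 0 := by
    rw [ratDeriv, div_eq_zero_iff] at h
    rcases h with h | h
    · exact RatFunc.algebraMap_injective ℚ (by rw [h, map_zero])
    · exact absurd h (RatFunc.algebraMap_ne_zero (pow_ne_zero 2 hd))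
  have hdvd : W.denom ∣ derivative W.denom :=
    W.isCoprime_num_denom.symm.dvd_of_dvd_mul_left
      ⟨derivative W.num, by linear_combination -h0⟩
  have hd' : derivative W.denom = 0 := by
    by_contra hne
    exact (degree_derivative_lt hd).not_ge (degree_le_of_dvd hdvd hne)
  have hn' : derivative W.num = 0 := by
    rw [hd', mul_zero, sub_zero] at h0
    exact (mul_eq_zero.mp h0).resolve_right hd
  have h1 := eq_C_of_natDegree_eq_zero (derivative_eq_zero.mp hn')
  have h2 := eq_C_of_natDegree_eq_zero (derivative_eq_zero.mp hd')
  refine ⟨W.num.coeff 0 / W.denom.coeff 0, ?_⟩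
  conv_lhs => rw [← W.num_div_denom, h1, h2]
  simp only [RatFunc.algebraMap_C, map_div₀]

theorem isUnit_of_logDeriv_eq {A B N M : ℚ[X]} (hA : A ≠ 0) (hB : B ≠ 0) (hM : M ≠ 0)
    (hNM : IsCoprime N M)
    (h : M ^ 2 * (derivative A * B - A * derivative B) =
      A * B * (derivative N * M - N * derivative M)) : IsUnit M := by
  by_contra hu
  obtain ⟨p, hp, hpM⟩ := WfDvdMonoid.exists_irreducible_factor hu hM
  have hp' : Prime p := hp.prime
  have hpN : ¬ p ∣ N := fun hpN => hp.not_isUnit (hNM.isUnit_of_dvd' hpN hpM)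
  have split : ∀ F : ℚ[X], F ≠ 0 → ∃ n F₁, ¬ p ∣ F₁ ∧ F = p ^ n * F₁ := fun F hF => by
    obtain ⟨F₁, h, hF₁⟩ :=
      (FiniteMultiplicity.of_not_isUnit hp.not_isUnit hF).exists_eq_pow_mul_and_not_dvd
    exact ⟨_, F₁, hF₁, h⟩
  obtain ⟨a, A₁, hA₁, rfl⟩ := split A hA
  obtain ⟨b, B₁, hB₁, rfl⟩ := split B hB
  obtain ⟨k, M₁, hM₁, rfl⟩ := split M hM
  have hk : k ≠ 0 := by
    rintro rfl
    exact hM₁ (by simpa using hpM)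
  have hderiv : ∀ (n : ℕ) (F : ℚ[X]), p * derivative (p ^ n * F) =
      p ^ n * (p * derivative F + C (n : ℚ) * derivative p * F) := fun n F => by
    rcases n with _ | n
    · simp
    · rw [derivative_mul, derivative_pow_succ]
      push_cast
      simp only [map_add, map_one, map_natCast]
      ring
  have hpp : ¬ p ∣ derivative p := fun hdvd => by
    have hne : derivative p ≠ 0 := fun h0 =>
      hp.natDegree_pos.ne' (derivative_eq_zero.mp h0)
    exact (degree_derivative_lt hp.ne_zero).not_ge (degree_le_of_dvd hdvd hne)
  have hpk : ¬ p ∣ C (k : ℚ) := fun hdvd =>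
    hp.not_isUnit (isUnit_of_dvd_unit hdvd (isUnit_C.mpr (by simpa using hk)))
  have hcancel : p ^ (a + b + k) * (p ^ k * M₁ ^ 2 *
        ((p * derivative A₁ + C (a : ℚ) * derivative p * A₁) * B₁ -
          A₁ * (p * derivative B₁ + C (b : ℚ) * derivative p * B₁))) =
      p ^ (a + b + k) * (A₁ * B₁ * (p * derivative N * M₁ -
        N * (p * derivative M₁ + C (k : ℚ) * derivative p * M₁))) := by
    linear_combination p * h - p ^ (2 * k) * M₁ ^ 2 * p ^ b * B₁ * hderiv a A₁ +
      p ^ (2 * k) * M₁ ^ 2 * p ^ a * A₁ * hderiv b B₁ -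
      p ^ (a + b) * A₁ * B₁ * N * hderiv k M₁
  have heq := mul_left_cancel₀ (pow_ne_zero _ hp.ne_zero) hcancel
  have hdvd : p ∣ A₁ * B₁ * N * C (k : ℚ) * derivative p * M₁ := by
    obtain ⟨l, rfl⟩ := Nat.exists_eq_succ_of_ne_zero hk
    refine ⟨A₁ * B₁ * (derivative N * M₁ - N * derivative M₁) - p ^ l * M₁ ^ 2 *
        ((p * derivative A₁ + C (a : ℚ) * derivative p * A₁) * B₁ -
          A₁ * (p * derivative B₁ + C (b : ℚ) * derivative p * B₁)), ?_⟩
    rw [pow_succ] at heq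
    linear_combination heq
  simp only [hp'.dvd_mul] at hdvd
  tauto

theorem ratDeriv_eq_zero_of_logDeriv_eq {R W : RatFunc ℚ}
    (h : ratDeriv R / R = ratDeriv W) : ratDeriv R = 0 := by
  have hB := R.denom_ne_zero
  have hM := W.denom_ne_zero
  rcases eq_or_ne R 0 with rfl | hR
  · simp [ratDeriv]
  have hA : R.num ≠ 0 := RatFunc.num_ne_zero hR
  have hA' := RatFunc.algebraMap_ne_zero hA
  have hB' := RatFunc.algebraMap_ne_zero hB
  have hM' := RatFunc.algebraMap_ne_zero hM
  have hpoly : W.denom ^ 2 * (derivative R.num * R.denom - R.num * derivative R.denom) =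
      R.num * R.denom * (derivative W.num * W.denom - W.num * derivative W.denom) := by
    apply RatFunc.algebraMap_injective ℚ
    rw [div_eq_iff hR] at h
    conv_rhs at h => rw [← R.num_div_denom]
    rw [ratDeriv, ratDeriv] at h
    rw [map_mul, map_mul, map_mul]
    simp only [map_pow] at h ⊢
    field_simp at h
    linear_combination h
  have hu := isUnit_of_logDeriv_eq hA hB hM W.isCoprime_num_denom hpoly
  have hdvd : R.num * R.denom ∣ derivative R.num * R.denom - R.num * derivative R.denom :=
    (hu.pow 2).dvd_mul_left.mp ⟨_, hpoly⟩
  suffices h0 : derivative R.num * R.denom - R.num * derivative R.denom = 0 by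
    rw [ratDeriv, h0, map_zero, zero_div]
  refine eq_zero_of_dvd_of_degree_lt hdvd ((degree_sub_le _ _).trans_lt (max_lt ?_ ?_))
  · rw [degree_mul, degree_mul]
    exact WithBot.add_lt_add_right (degree_ne_bot.mpr hB) (degree_derivative_lt hA)
  · rw [degree_mul, degree_mul]
    exact WithBot.add_lt_add_left (degree_ne_bot.mpr hA) (degree_derivative_lt hB)

theorem eq_zero_of_C_mul_ratDeriv_add_eq_zero {P Q : RatFunc ℚ}
    (hPQ : LinearIndependent ℚ ![P, Q, (1 : RatFunc ℚ)]) {a b : ℚ}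
    (h : RatFunc.C a * ratDeriv P + RatFunc.C b * ratDeriv Q = 0) : a = 0 ∧ b = 0 := by
  rw [← ratDeriv_C_mul_add_C_mul] at h
  obtain ⟨c, hc⟩ := eq_C_of_ratDeriv_eq_zero h
  obtain ⟨ha, hb, -⟩ := linearIndependent_iff_C_mul.mp hPQ a b (-c) (by
    rw [map_neg]
    linear_combination hc)
  exact ⟨ha, hb⟩

theorem linearIndependent_ratDeriv_logDeriv {P Q R S : RatFunc ℚ}
    (hPQ : LinearIndependent ℚ ![P, Q, (1 : RatFunc ℚ)])
    (hR : R = ratDeriv P / ratDeriv Q) (hS : S = ratDeriv R / R) :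
    LinearIndependent ℚ ![ratDeriv P, ratDeriv Q, S] := by
  have hlin := @eq_zero_of_C_mul_ratDeriv_add_eq_zero P Q hPQ
  rw [linearIndependent_iff_C_mul]
  intro a b c hg
  have hc : c = 0 := by
    by_contra hc
    have hc' : RatFunc.C c ≠ 0 := by simpa using hc
    have hW : ratDeriv R / R =
        ratDeriv (RatFunc.C (-a / c) * P + RatFunc.C (-b / c) * Q) := by
      rw [ratDeriv_C_mul_add_C_mul, ← hS]
      simp only [map_div₀, map_neg]
      field_simp
      linear_combination hg
    obtain ⟨r, hr⟩ := eq_C_of_ratDeriv_eq_zero (ratDeriv_eq_zero_of_logDeriv_eq hW)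
    have hQ : ratDeriv Q ≠ 0 := fun hQ => by
      have := (@hlin 0 1 (by simp [hQ])).2
      norm_num at this
    have := (@hlin 1 (-r) (by
      rw [hR, div_eq_iff hQ] at hr
      simp [hr])).1
    norm_num at this
  obtain ⟨ha, hb⟩ := @hlin a b (by simpa only [hc, map_zero, zero_mul, add_zero] using hg)
  exact ⟨ha, hb, hc⟩

theorem substAt_mul_aeval {n : ℕ} {f : RatFunc ℚ} {g h : ℚ[X]}
    (hf : f * algebraMap ℚ[X] (RatFunc ℚ) h = algebraMap ℚ[X] (RatFunc ℚ) g) (i : Fin n) :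
    substAt f i * algebraMap _ _ (aeval (MvPolynomial.X i : MvPolynomial (Fin n) ℚ) h) =
      algebraMap _ _ (aeval (MvPolynomial.X i : MvPolynomial (Fin n) ℚ) g) := by
  have heval : ∀ q : ℚ[X], Polynomial.eval₂
      ((algebraMap (MvPolynomial (Fin n) ℚ) (FractionRing (MvPolynomial (Fin n) ℚ))).comp
        MvPolynomial.C)
      (algebraMap (MvPolynomial (Fin n) ℚ) (FractionRing (MvPolynomial (Fin n) ℚ))
        (MvPolynomial.X i)) q =
      algebraMap _ _ (aeval (MvPolynomial.X i : MvPolynomial (Fin n) ℚ) q) := fun q => by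
    rw [aeval_def, hom_eval₂]
    rfl
  have hinj : Function.Injective
      (aeval (MvPolynomial.X i : MvPolynomial (Fin n) ℚ) : ℚ[X] →ₐ[ℚ] _) :=
    transcendental_iff_injective.mp (MvPolynomial.transcendental_X ℚ i)
  have hden : algebraMap (MvPolynomial (Fin n) ℚ) (FractionRing (MvPolynomial (Fin n) ℚ))
      (aeval (MvPolynomial.X i) f.denom) ≠ 0 := by
    rw [Ne, FaithfulSMul.algebraMap_eq_zero_iff, map_eq_zero_iff _ hinj]
    exact f.denom_ne_zero
  have hcross : f.num * h = g * f.denom := by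
    apply RatFunc.algebraMap_injective ℚ
    have hd := RatFunc.algebraMap_ne_zero f.denom_ne_zero
    conv_lhs at hf => rw [← f.num_div_denom]
    rw [map_mul, map_mul]
    field_simp at hf
    linear_combination hf
  rw [substAt, heval, heval, div_mul_eq_mul_div, div_eq_iff hden]
  simp only [← map_mul, hcross]

theorem exists_det_eval_ne_zero {g₀ g₁ g₂ : ℚ[X]}
    (hg : ∀ a b c : ℚ, C a * g₀ + C b * g₁ + C c * g₂ = 0 → a = 0 ∧ b = 0 ∧ c = 0) :
    ∃ x : Fin 3 → ℚ, Matrix.det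
      !![g₀.eval (x 0), g₀.eval (x 1), g₀.eval (x 2);
         g₁.eval (x 0), g₁.eval (x 1), g₁.eval (x 2);
         g₂.eval (x 0), g₂.eval (x 1), g₂.eval (x 2)] ≠ 0 := by
  have hev : ∀ q : ℚ[X], q ≠ 0 → ∃ x, q.eval x ≠ 0 := fun q hq => by
    by_contra! hq'
    exact hq (Polynomial.funext (by simpa using hq'))
  obtain ⟨x₀, h₀⟩ := hev g₀ fun h => by simpa using (hg 1 0 0 (by simp [h])).1
  obtain ⟨x₁, h₁⟩ := hev (C (-g₁.eval x₀) * g₀ + C (g₀.eval x₀) * g₁ + C 0 * g₂)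
    fun h => h₀ (hg _ _ _ h).2.1
  simp only [eval_add, eval_mul, eval_C, zero_mul, add_zero] at h₁
  obtain ⟨x₂, h₂⟩ := hev
    (C (g₁.eval x₀ * g₂.eval x₁ - g₁.eval x₁ * g₂.eval x₀) * g₀ +
      C (-(g₀.eval x₀ * g₂.eval x₁ - g₀.eval x₁ * g₂.eval x₀)) * g₁ +
      C (-g₁.eval x₀ * g₀.eval x₁ + g₀.eval x₀ * g₁.eval x₁) * g₂)
    fun h => h₁ (hg _ _ _ h).2.2
  simp only [eval_add, eval_mul, eval_C] at h₂
  refine ⟨![x₀, x₁, x₂], fun hdet => h₂ ?_⟩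
  rw [Matrix.det_fin_three] at hdet
  simp at hdet
  linear_combination hdet

theorem det_substAt_ne_zero {f₀ f₁ f₂ : RatFunc ℚ} (hf : LinearIndependent ℚ ![f₀, f₁, f₂]) :
    Matrix.det
      !![substAt f₀ (0 : Fin 3), substAt f₀ 1, substAt f₀ 2;
         substAt f₁ 0, substAt f₁ 1, substAt f₁ 2;
         substAt f₂ 0, substAt f₂ 1, substAt f₂ 2] ≠ 0 := by
  intro hdet
  obtain ⟨h, g₀, g₁, g₂, hh, hg₀, hg₁, hg₂⟩ : ∃ h g₀ g₁ g₂ : ℚ[X], h ≠ 0 ∧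
      f₀ * algebraMap ℚ[X] (RatFunc ℚ) h = algebraMap ℚ[X] (RatFunc ℚ) g₀ ∧
      f₁ * algebraMap ℚ[X] (RatFunc ℚ) h = algebraMap ℚ[X] (RatFunc ℚ) g₁ ∧
      f₂ * algebraMap ℚ[X] (RatFunc ℚ) h = algebraMap ℚ[X] (RatFunc ℚ) g₂ := by
    have hmul : ∀ f : RatFunc ℚ, f * algebraMap ℚ[X] (RatFunc ℚ) f.denom =
        algebraMap ℚ[X] (RatFunc ℚ) f.num := fun f => by
      have hd := RatFunc.algebraMap_ne_zero f.denom_ne_zero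
      exact ((div_eq_iff hd).mp f.num_div_denom).symm
    refine ⟨f₀.denom * f₁.denom * f₂.denom, f₀.num * f₁.denom * f₂.denom,
      f₁.num * f₀.denom * f₂.denom, f₂.num * f₀.denom * f₁.denom,
      mul_ne_zero (mul_ne_zero f₀.denom_ne_zero f₁.denom_ne_zero) f₂.denom_ne_zero, ?_, ?_, ?_⟩ <;>
    simp only [map_mul, ← hmul] <;> ring
  have hind : ∀ a b c : ℚ, C a * g₀ + C b * g₁ + C c * g₂ = 0 → a = 0 ∧ b = 0 ∧ c = 0 := by
    intro a b c habc
    have hz := congrArg (algebraMap ℚ[X] (RatFunc ℚ)) habc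
    simp only [map_add, map_mul, map_zero, ← hg₀, ← hg₁, ← hg₂, RatFunc.algebraMap_C] at hz
    apply linearIndependent_iff_C_mul.mp hf
    apply mul_right_cancel₀ (RatFunc.algebraMap_ne_zero hh)
    linear_combination hz
  obtain ⟨x, hx⟩ := exists_det_eval_ne_zero hind
  have hpoly : Matrix.det
      !![aeval (MvPolynomial.X 0 : MvPolynomial (Fin 3) ℚ) g₀, aeval (MvPolynomial.X 1) g₀,
          aeval (MvPolynomial.X 2) g₀;
        aeval (MvPolynomial.X 0) g₁, aeval (MvPolynomial.X 1) g₁, aeval (MvPolynomial.X 2) g₁;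
        aeval (MvPolynomial.X 0) g₂, aeval (MvPolynomial.X 1) g₂,
          aeval (MvPolynomial.X 2) g₂] = 0 := by
    apply FaithfulSMul.algebraMap_injective (MvPolynomial (Fin 3) ℚ)
      (FractionRing (MvPolynomial (Fin 3) ℚ))
    rw [Matrix.det_fin_three] at hdet ⊢
    simp only [Matrix.of_apply, Matrix.cons_val', Matrix.cons_val] at hdet ⊢
    simp only [map_add, map_sub, map_mul, map_zero, ← substAt_mul_aeval hg₀,
      ← substAt_mul_aeval hg₁, ← substAt_mul_aeval hg₂]
    linear_combination (algebraMap (MvPolynomial (Fin 3) ℚ) (FractionRing _)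
        (aeval (MvPolynomial.X 0) h) *
      algebraMap (MvPolynomial (Fin 3) ℚ) (FractionRing _) (aeval (MvPolynomial.X 1) h) *
      algebraMap (MvPolynomial (Fin 3) ℚ) (FractionRing _) (aeval (MvPolynomial.X 2) h)) * hdet
  apply hx
  have heval : ∀ (i : Fin 3) (q : ℚ[X]),
      MvPolynomial.aeval x (aeval (MvPolynomial.X i : MvPolynomial (Fin 3) ℚ) q) =
        q.eval (x i) := fun i q => by
    rw [← aeval_algHom_apply, MvPolynomial.aeval_X, coe_aeval_eq_eval]
  have hz := congrArg (MvPolynomial.aeval x : MvPolynomial (Fin 3) ℚ →ₐ[ℚ] ℚ) hpoly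
  rw [Matrix.det_fin_three] at hz ⊢
  simpa only [Matrix.of_apply, Matrix.cons_val', Matrix.cons_val, map_add, map_sub, map_mul,
    map_zero, heval] using hz

/-- **Step 3 of Theorem 4.2.** Nonvanishing of the determinant `D(y₁,y₄,y₆)` in the rational
function field `ℚ(y₁,y₄,y₆)`, where `R = P′/Q′` and `S = R′/R`. -/
theorem D_ne_zero (P Q : RatFunc ℚ)
    (hPQ : LinearIndependent ℚ ![P, Q, (1 : RatFunc ℚ)])
    (R S : RatFunc ℚ) (hR : R = ratDeriv P / ratDeriv Q) (hS : S = ratDeriv R / R) :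
    Matrix.det
      !![substAt (ratDeriv P) (0 : Fin 3), substAt (ratDeriv P) 1, substAt (ratDeriv P) 2;
         substAt (ratDeriv Q) 0, substAt (ratDeriv Q) 1, substAt (ratDeriv Q) 2;
         substAt S 0, substAt S 1, substAt S 2] ≠ 0 := by
  exact det_substAt_ne_zero (linearIndependent_ratDeriv_logDeriv hPQ hR hS)
end RatCorners
end
end

section
/- There exists a constant C > 0 depending only on P and Q such that for every admissible prime p and every pair (a,b) ∈ F_p^2, the number of tuples (y2,y3,y5,y7,y8) ∈ F_p^5, avoiding all poles of P and Q, satisfying −P(y2)−P(y3)−P(y5)+P(y7)−P(y8) = a and −Q(y2)−Q(y3)−Q(y5)+Q(y7)−Q(y8) = b, is at most C · p^3 (with C independent of a and b). -/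
open scoped BigOperators ComplexOrder
open Polynomial

noncomputable section

namespace RatCorners

variable (p : ℕ) [NeZero p]

/-- Polynomial functions on the plane of total degree less than `n`. -/
def planePoly (F : Type*) [Field F] (n : ℕ) : Submodule F (F × F → F) :=
  Submodule.span F {f | ∃ i j : ℕ, i + j < n ∧ f = fun w => w.1 ^ i * w.2 ^ j}

section PlanePoly

variable {F : Type*} [Field F]

lemma monomial_mem_planePoly {i j n : ℕ} (h : i + j < n) :
    (fun w : F × F => w.1 ^ i * w.2 ^ j) ∈ planePoly F n :=
  Submodule.subset_span ⟨i, j, h, rfl⟩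

lemma planePoly_mono {m n : ℕ} (h : m ≤ n) : planePoly F m ≤ planePoly F n := by
  refine Submodule.span_mono ?_
  rintro f ⟨i, j, hij, rfl⟩
  exact ⟨i, j, hij.trans_le h, rfl⟩

lemma planePoly_zero : planePoly F 0 = ⊥ := by
  simp [planePoly]

lemma fst_mul_mem_planePoly {n : ℕ} {f : F × F → F} (hf : f ∈ planePoly F n) :
    (fun w => w.1 * f w) ∈ planePoly F (n + 1) := by
  induction hf using Submodule.span_induction with
  | mem f hf =>
    obtain ⟨i, j, hij, rfl⟩ := hf
    convert monomial_mem_planePoly (F := F) (show (i + 1) + j < n + 1 by omega) using 2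
    ring
  | zero =>
    convert (planePoly F (n + 1)).zero_mem using 2
    simp
  | add f g _ _ hf hg =>
    convert add_mem hf hg using 2
    simp [mul_add]
  | smul c f _ hf =>
    convert Submodule.smul_mem _ c hf using 2
    simp [mul_left_comm]

lemma snd_mul_mem_planePoly {n : ℕ} {f : F × F → F} (hf : f ∈ planePoly F n) :
    (fun w => w.2 * f w) ∈ planePoly F (n + 1) := by
  induction hf using Submodule.span_induction with
  | mem f hf =>
    obtain ⟨i, j, hij, rfl⟩ := hf
    convert monomial_mem_planePoly (F := F) (show i + (j + 1) < n + 1 by omega) using 2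
    ring
  | zero =>
    convert (planePoly F (n + 1)).zero_mem using 2
    simp
  | add f g _ _ hf hg =>
    convert add_mem hf hg using 2
    simp [mul_add]
  | smul c f _ hf =>
    convert Submodule.smul_mem _ c hf using 2
    simp [mul_left_comm]

lemma monomial_difference_mem_planePoly (v : F × F) (i j : ℕ) :
    (fun w : F × F => (w + v).1 ^ i * (w + v).2 ^ j - w.1 ^ i * w.2 ^ j) ∈
      planePoly F (i + j) := by
  have shift : ∀ {i j : ℕ}, (fun w : F × F =>
      (w + v).1 ^ i * (w + v).2 ^ j - w.1 ^ i * w.2 ^ j) ∈ planePoly F (i + j) →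
      (fun w : F × F => (w + v).1 ^ i * (w + v).2 ^ j) ∈ planePoly F (i + j + 1) := by
    intro i j h
    convert add_mem (planePoly_mono (Nat.le_succ _) h)
      (monomial_mem_planePoly (F := F) (Nat.lt_succ_self (i + j))) using 2
    simp
  induction i with
  | zero =>
    induction j with
    | zero =>
      convert (planePoly F 0).zero_mem using 2
      simp
    | succ j ih =>
      rw [← Nat.add_assoc]
      convert add_mem (snd_mul_mem_planePoly ih) (Submodule.smul_mem _ v.2 (shift ih)) using 2
      simp only [Pi.add_apply, Pi.smul_apply, smul_eq_mul, Prod.snd_add]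
      ring
  | succ i ih =>
    rw [Nat.add_right_comm]
    convert add_mem (fst_mul_mem_planePoly ih) (Submodule.smul_mem _ v.1 (shift ih)) using 2
    simp only [Pi.add_apply, Pi.smul_apply, smul_eq_mul, Prod.fst_add]
    ring

lemma difference_mem_planePoly {n : ℕ} {f : F × F → F} (hf : f ∈ planePoly F (n + 1))
    (v : F × F) : (fun w => f (w + v) - f w) ∈ planePoly F n := by
  induction hf using Submodule.span_induction with
  | mem f hf =>
    obtain ⟨i, j, hij, rfl⟩ := hf
    exact planePoly_mono (by omega) (monomial_difference_mem_planePoly v i j)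
  | zero =>
    convert (planePoly F n).zero_mem using 2
    simp
  | add f g _ _ hf hg =>
    convert add_mem hf hg using 2
    simp only [Pi.add_apply]
    ring
  | smul c f _ hf =>
    convert Submodule.smul_mem _ c hf using 2
    simp [mul_sub]

lemma translate_mem_planePoly {n : ℕ} {f : F × F → F} (hf : f ∈ planePoly F n)
    (v : F × F) : (fun w => f (w + v)) ∈ planePoly F n := by
  cases n with
  | zero =>
    rw [planePoly_zero, Submodule.mem_bot] at hf ⊢
    simp [hf, funext_iff]
  | succ n =>
    convert add_mem (planePoly_mono (Nat.le_succ n) (difference_mem_planePoly hf v)) hf using 2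
    simp

lemma neg_mem_planePoly {n : ℕ} {f : F × F → F} (hf : f ∈ planePoly F n) :
    (fun w => f (-w)) ∈ planePoly F n := by
  induction hf using Submodule.span_induction with
  | mem f hf =>
    obtain ⟨i, j, hij, rfl⟩ := hf
    convert Submodule.smul_mem _ ((-1 : F) ^ (i + j)) (monomial_mem_planePoly (F := F) hij)
      using 2 with w
    simp only [Pi.smul_apply, smul_eq_mul, Prod.fst_neg, Prod.snd_neg]
    rw [neg_pow w.1, neg_pow w.2]
    ring
  | zero =>
    convert (planePoly F n).zero_mem using 2
    simp
  | add f g _ _ hf hg => exact add_mem hf hg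
  | smul c f _ hf => exact Submodule.smul_mem _ c hf

lemma reflect_mem_planePoly {n : ℕ} {f : F × F → F} (hf : f ∈ planePoly F n)
    (c : F × F) : (fun w => f (c - w)) ∈ planePoly F n := by
  convert neg_mem_planePoly (translate_mem_planePoly hf c) using 3
  abel

/-- Along a rational parametrized curve with denominator `E`, a polynomial function of the plane
becomes a polynomial after multiplication by a power of `E`. -/
lemma exists_polynomial_along_curve {m e : ℕ} {f : F × F → F} (hf : f ∈ planePoly F (m + 1))
    {A B E : F[X]} (hA : A.natDegree ≤ e) (hB : B.natDegree ≤ e) (hE : E.natDegree ≤ e) :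
    ∃ R : F[X], R.natDegree ≤ m * e ∧ ∀ y, E.eval y ≠ 0 →
      R.eval y = E.eval y ^ m * f (A.eval y / E.eval y, B.eval y / E.eval y) := by
  induction hf using Submodule.span_induction with
  | mem f hf =>
    obtain ⟨i, j, hij, rfl⟩ := hf
    refine ⟨A ^ i * B ^ j * E ^ (m - (i + j)), ?_, fun y hy => ?_⟩
    · calc _ ≤ i * e + j * e + (m - (i + j)) * e :=
            natDegree_mul_le_of_le (natDegree_mul_le_of_le (natDegree_pow_le_of_le i hA)
              (natDegree_pow_le_of_le j hB)) (natDegree_pow_le_of_le _ hE)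
        _ = m * e := by rw [← add_mul, ← add_mul]; congr 1; omega
    · obtain ⟨k, rfl⟩ : ∃ k, m = i + j + k := ⟨m - (i + j), by omega⟩
      simp only [eval_mul, eval_pow, div_pow, Nat.add_sub_cancel_left]
      field_simp
      ring
  | zero => exact ⟨0, by simp, by simp⟩
  | add f g _ _ hf hg =>
    obtain ⟨R, hR, hR'⟩ := hf
    obtain ⟨S, hS, hS'⟩ := hg
    exact ⟨R + S, natDegree_add_le_of_degree_le hR hS, fun y hy => by
      simp [hR' y hy, hS' y hy, mul_add]⟩
  | smul c f _ hf =>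
    obtain ⟨R, hR, hR'⟩ := hf
    exact ⟨C c * R, (natDegree_C_mul_le c R).trans hR, fun y hy => by
      simp [hR' y hy, mul_left_comm]⟩

end PlanePoly

section Curve

variable {F : Type*} [Field F] [Fintype F]

lemma card_zeros_le [DecidableEq F] {R : F[X]} (hR : R ≠ 0) {d : ℕ} (hd : R.natDegree ≤ d) :
    (Finset.univ.filter fun y => R.eval y = 0).card ≤ d := by
  refine le_trans (Finset.card_le_card ?_) ((Multiset.toFinset_card_le R.roots).trans
    ((card_roots' R).trans hd))
  intro y hy
  simpa [hR] using hy

lemma coeff_eq_zero_of_sum_pow_eq_zero {k : ℕ} (hk : k ≤ Fintype.card F) (h : Fin k → F)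
    (h0 : ∀ x : F, ∑ i, h i * x ^ (i : ℕ) = 0) : h = 0 := by
  set R : F[X] := ∑ i, C (h i) * X ^ (i : ℕ) with hR
  have hdeg : R.degree < Fintype.card F := by
    refine (degree_sum_le _ _).trans_lt ((Finset.sup_lt_iff (WithBot.bot_lt_coe _)).2 ?_)
    intro i _
    refine (degree_C_mul_X_pow_le _ _).trans_lt ?_
    exact_mod_cast i.2.trans_le hk
  have hR0 : R = 0 := by
    refine eq_zero_of_degree_lt_of_eval_finset_eq_zero Finset.univ
      (by simpa using hdeg) fun x _ => ?_
    simpa [hR, eval_finsetSum] using h0 x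
  funext i
  have := congrArg (fun S => coeff S i) hR0
  simpa [hR, finsetSum_coeff, coeff_X_pow, Fin.val_inj] using this

/-- A rationally parametrized plane curve lies on an algebraic curve of bounded degree. -/
lemma exists_equation_of_curve {e : ℕ} (he : 1 ≤ e) (hF : 2 * e < Fintype.card F)
    {A B E : F[X]} (hA : A.natDegree ≤ e) (hB : B.natDegree ≤ e) (hE : E.natDegree ≤ e) :
    ∃ f ∈ planePoly F (4 * e + 1), f ≠ 0 ∧ ∀ y, E.eval y ≠ 0 →
      f (A.eval y / E.eval y, B.eval y / E.eval y) = 0 := by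
  let ι := Fin (2 * e + 1)
  let M : ι × ι → F[X] := fun s => A ^ (s.1 : ℕ) * B ^ (s.2 : ℕ) * E ^ (4 * e - (s.1 + s.2))
  have hM : ∀ s, M s ∈ degreeLT F (4 * e * e + 1) := by
    intro s
    rw [mem_degreeLT]
    refine lt_of_le_of_lt (degree_le_of_natDegree_le (n := 4 * e * e) ?_)
      (by exact_mod_cast Nat.lt_succ_self _)
    have h1 := s.1.2
    have h2 := s.2.2
    calc _ ≤ s.1 * e + s.2 * e + (4 * e - (s.1 + s.2)) * e :=
          natDegree_mul_le_of_le (natDegree_mul_le_of_le (natDegree_pow_le_of_le _ hA)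
            (natDegree_pow_le_of_le _ hB)) (natDegree_pow_le_of_le _ hE)
      _ = 4 * e * e := by rw [← add_mul, ← add_mul]; congr 1; omega
  let Φ : (ι × ι → F) →ₗ[F] degreeLT F (4 * e * e + 1) :=
    Fintype.linearCombination F fun s => (⟨M s, hM s⟩ : degreeLT F (4 * e * e + 1))
  have hker : Φ.ker ≠ ⊥ := by
    have : Module.Finite F (degreeLT F (4 * e * e + 1)) :=
      Module.Finite.equiv (degreeLTEquiv F _).symm
    refine LinearMap.ker_ne_bot_of_finrank_lt ?_
    rw [(degreeLTEquiv F _).finrank_eq]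
    simp only [Module.finrank_fintype_fun_eq_card, Fintype.card_fin, Fintype.card_prod, ι]
    nlinarith
  obtain ⟨h, hh, hne⟩ := Submodule.exists_mem_ne_zero_of_ne_bot hker
  have hsum : ∑ s, C (h s) * M s = 0 := by
    have := congrArg Subtype.val (LinearMap.mem_ker.1 hh)
    simpa [Φ, Fintype.linearCombination_apply, smul_eq_C_mul] using this
  refine ⟨∑ s : ι × ι, h s • fun w => w.1 ^ (s.1 : ℕ) * w.2 ^ (s.2 : ℕ), ?_, ?_, ?_⟩
  · refine Submodule.sum_mem _ fun s _ => Submodule.smul_mem _ _ (monomial_mem_planePoly ?_)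
    have h1 := s.1.2
    have h2 := s.2.2
    omega
  · intro h0
    refine hne ?_
    have key : ∀ x z : F, ∑ i : ι, (∑ j : ι, h (i, j) * z ^ (j : ℕ)) * x ^ (i : ℕ) = 0 := by
      intro x z
      have := congrFun h0 (x, z)
      simp only [Finset.sum_apply, Pi.smul_apply, smul_eq_mul, Pi.zero_apply,
        Fintype.sum_prod_type] at this
      rw [← this]
      refine Finset.sum_congr rfl fun i _ => ?_
      rw [Finset.sum_mul]
      exact Finset.sum_congr rfl fun j _ => by ring
    funext ⟨i, j⟩
    refine congrFun (coeff_eq_zero_of_sum_pow_eq_zero hF (fun j => h (i, j)) fun z => ?_) j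
    exact congrFun (coeff_eq_zero_of_sum_pow_eq_zero hF _ fun x => key x z) i
  · intro y hy
    have := congrArg (eval y) hsum
    rw [eval_finsetSum, eval_zero] at this
    rw [← mul_right_inj' (pow_ne_zero (4 * e) hy), mul_zero, ← this, Finset.sum_apply,
      Finset.mul_sum]
    refine Finset.sum_congr rfl fun s _ => ?_
    have h1 := s.1.2
    have h2 := s.2.2
    obtain ⟨k, hk⟩ : ∃ k, 4 * e = s.1 + s.2 + k := ⟨4 * e - (s.1 + s.2), by omega⟩
    simp only [M, eval_mul, eval_C, eval_pow, Pi.smul_apply, smul_eq_mul, div_pow]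
    rw [hk, Nat.add_sub_cancel_left]
    field_simp
    ring

end Curve

section Periodic

variable {p : ℕ} [Fact p.Prime]

lemma card_filter_linear_eq_le {A B E : (ZMod p)[X]}
    (hind : LinearIndependent (ZMod p) ![A, B, E]) {e : ℕ} (hA : A.natDegree ≤ e)
    (hB : B.natDegree ≤ e) (hE : E.natDegree ≤ e) {α β : ZMod p} (hαβ : α ≠ 0 ∨ β ≠ 0)
    (r : ZMod p) :
    (Finset.univ.filter fun y => E.eval y ≠ 0 ∧
      α * (A.eval y / E.eval y) + β * (B.eval y / E.eval y) = r).card ≤ e := by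
  have hR : α • A + β • B + (-r) • E ≠ 0 := by
    intro h0
    have h := Fintype.linearIndependent_iff.1 hind ![α, β, -r]
      (by simpa [Fin.sum_univ_three] using h0)
    have h1 := h 0
    have h2 := h 1
    simp only [Matrix.cons_val_zero, Matrix.cons_val_one] at h1 h2
    exact hαβ.elim (· h1) (· h2)
  refine (Finset.card_le_card ?_).trans (card_zeros_le hR (d := e) ?_)
  · intro y
    simp only [Finset.mem_filter, Finset.mem_univ, true_and, eval_add, eval_smul, smul_eq_mul]
    rintro ⟨hy, rfl⟩
    field_simp
    ring
  · exact natDegree_add_le_of_degree_le (natDegree_add_le_of_degree_le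
      ((natDegree_smul_le _ _).trans hA) ((natDegree_smul_le _ _).trans hB))
      ((natDegree_smul_le _ _).trans hE)

/-- A polynomial function of small degree with a nonzero period cannot vanish on a curve which is
not contained in a line. -/
lemma eq_zero_of_periodic_of_vanishes {A B E : (ZMod p)[X]}
    (hind : LinearIndependent (ZMod p) ![A, B, E]) {e m : ℕ} (hA : A.natDegree ≤ e)
    (hB : B.natDegree ≤ e) (hE : E.natDegree ≤ e) (hp : (m + 1) * e < p)
    {K : ZMod p × ZMod p → ZMod p} (hK : K ∈ planePoly (ZMod p) (m + 1))
    (hvan : ∀ y, E.eval y ≠ 0 → K (A.eval y / E.eval y, B.eval y / E.eval y) = 0)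
    {v : ZMod p × ZMod p} (hv : v ≠ 0) (hper : ∀ w, K (w + v) = K w) : K = 0 := by
  have hper' : ∀ (s : ZMod p) w, K (w + s • v) = K w := by
    have hnat : ∀ (n : ℕ) w, K (w + (n : ZMod p) • v) = K w := by
      intro n
      induction n with
      | zero => simp
      | succ n ih =>
        intro w
        rw [Nat.cast_succ, add_smul, one_smul, ← add_assoc, hper, ih]
    intro s w
    simpa using hnat s.val w
  have hv' : v.2 ≠ 0 ∨ -v.1 ≠ 0 := by
    by_contra! h
    exact hv (Prod.ext (neg_eq_zero.1 h.2) h.1)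
  obtain ⟨d, hd⟩ : ∃ d : ZMod p × ZMod p, ∀ w : ZMod p × ZMod p,
      K ((v.2 * w.1 + -v.1 * w.2) • d) = K w := by
    rcases hv' with h | h
    · refine ⟨(v.2⁻¹, 0), fun w => ?_⟩
      rw [← hper' (w.2 / v.2)]
      congr 1
      ext <;> simp <;> field_simp
      ring
    · refine ⟨(0, (-v.1)⁻¹), fun w => ?_⟩
      have h' : v.1 ≠ 0 := neg_ne_zero.1 h
      rw [← hper' (w.1 / v.1)]
      congr 1
      ext <;> simp <;> field_simp
      ring
  obtain ⟨R, hR, hRK⟩ := exists_polynomial_along_curve (e := 1) hK (A := C d.1 * X)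
    (B := C d.2 * X) (E := 1) ((natDegree_C_mul_le _ _).trans natDegree_X_le)
    ((natDegree_C_mul_le _ _).trans natDegree_X_le) (by simp)
  have hRK' : ∀ t, R.eval t = K (t • d) := by
    intro t
    simpa [mul_comm t, Prod.smul_def] using hRK t (by simp)
  by_contra hne
  have hR0 : R ≠ 0 := by
    rintro rfl
    refine hne (funext fun w => ?_)
    rw [← hd w, ← hRK', eval_zero, Pi.zero_apply]
  have hE0 : E ≠ 0 := by simpa using hind.ne_zero 2
  have h1 : (Finset.univ.filter fun y : ZMod p => E.eval y ≠ 0).card ≤ e * m := by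
    refine (Finset.card_le_mul_card_image_of_maps_to
      (f := fun y => v.2 * (A.eval y / E.eval y) + -v.1 * (B.eval y / E.eval y))
      (t := Finset.univ.filter fun t => R.eval t = 0) ?_ e ?_).trans
        (Nat.mul_le_mul_left e (card_zeros_le hR0 (by simpa using hR)))
    · intro y hy
      simp only [Finset.mem_filter, Finset.mem_univ, true_and] at hy ⊢
      rw [hRK', ← hvan y hy]
      exact hd (_, _)
    · intro t _
      rw [Finset.filter_filter]
      exact card_filter_linear_eq_le hind hA hB hE hv' t
  have h2 := card_zeros_le hE0 hE
  have h3 := Finset.card_filter_add_card_filter_not (s := (Finset.univ : Finset (ZMod p)))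
    (fun y => E.eval y = 0)
  rw [Finset.card_univ, ZMod.card] at h3
  nlinarith

/-- For all but at most one `c`, the number of `x` whose image on the curve is a summand of a
decomposition of `c` into two points of the curve is bounded. -/
lemma exists_exceptional_sum {A B E : (ZMod p)[X]}
    (hind : LinearIndependent (ZMod p) ![A, B, E]) {e : ℕ} (he : 1 ≤ e) (hA : A.natDegree ≤ e)
    (hB : B.natDegree ≤ e) (hE : E.natDegree ≤ e) (hp : (4 * e + 1) * e < p)
    {γ : ZMod p → ZMod p × ZMod p}
    (hγ : ∀ y, E.eval y ≠ 0 → γ y = (A.eval y / E.eval y, B.eval y / E.eval y)) :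
    ∃ c₀, ∀ c, c ≠ c₀ → ((Finset.univ.filter fun y => E.eval y ≠ 0).filter fun x =>
      ∃ y ∈ Finset.univ.filter fun y => E.eval y ≠ 0, γ x + γ y = c).card ≤ 4 * e * e := by
  classical
  have hex : ∃ n, ∃ f ∈ planePoly (ZMod p) n, f ≠ 0 ∧ ∀ y, E.eval y ≠ 0 → f (γ y) = 0 := by
    obtain ⟨f, hf, hf0, hfv⟩ := exists_equation_of_curve (F := ZMod p) he
      (by rw [ZMod.card]; nlinarith) hA hB hE
    exact ⟨_, f, hf, hf0, fun y hy => by rw [hγ y hy, hfv y hy]⟩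
  have hmin : Nat.find hex ≤ 4 * e + 1 := by
    obtain ⟨f, hf, hf0, hfv⟩ := exists_equation_of_curve (F := ZMod p) he
      (by rw [ZMod.card]; nlinarith) hA hB hE
    exact Nat.find_min' hex ⟨f, hf, hf0, fun y hy => by rw [hγ y hy, hfv y hy]⟩
  obtain ⟨f, hf, hf0, hfv⟩ := Nat.find_spec hex
  obtain ⟨m, hm⟩ : ∃ m, Nat.find hex = m + 1 := by
    refine Nat.exists_eq_succ_of_ne_zero fun h => hf0 ?_
    rwa [h, planePoly_zero, Submodule.mem_bot] at hf
  have hlow : ∀ g ∈ planePoly (ZMod p) m, (∀ y, E.eval y ≠ 0 → g (γ y) = 0) → g = 0 := by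
    intro g hg hgv
    by_contra hg0
    exact Nat.find_min hex (m := m) (by omega) ⟨g, hg, hg0, hgv⟩
  rw [hm] at hf hmin
  have huniq : ∀ c c', (∀ y, E.eval y ≠ 0 → f (c - γ y) = 0) →
      (∀ y, E.eval y ≠ 0 → f (c' - γ y) = 0) → c = c' := by
    intro c c' hc hc'
    by_contra hne
    have hK := reflect_mem_planePoly hf c
    have hper := hlow _ (difference_mem_planePoly hK (c - c')) fun y hy => by
      rw [hc y hy, show c - (γ y + (c - c')) = c' - γ y by abel, hc' y hy, sub_zero]
    have hK0 := eq_zero_of_periodic_of_vanishes hind hA hB hE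
      (lt_of_le_of_lt (Nat.mul_le_mul_right e hmin) hp) hK
      (fun y hy => by rw [← hγ y hy]; exact hc y hy)
      (sub_ne_zero.2 hne) fun w => sub_eq_zero.1 (congrFun hper w)
    refine hf0 (funext fun w => ?_)
    simpa using congrFun hK0 (c - w)
  have hbound : ∀ c, (¬ ∀ y, E.eval y ≠ 0 → f (c - γ y) = 0) →
      ((Finset.univ.filter fun y => E.eval y ≠ 0).filter fun x =>
        ∃ y ∈ Finset.univ.filter fun y => E.eval y ≠ 0, γ x + γ y = c).card ≤ 4 * e * e := by
    intro c hc
    obtain ⟨R, hR, hRf⟩ := exists_polynomial_along_curve (reflect_mem_planePoly hf c) hA hB hE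
    have hR0 : R ≠ 0 := by
      rintro rfl
      refine hc fun y hy => ?_
      have := hRf y hy
      rw [eval_zero, ← hγ y hy] at this
      exact (mul_eq_zero.1 this.symm).resolve_left (pow_ne_zero _ hy)
    refine (Finset.card_le_card fun x hx => ?_).trans (card_zeros_le hR0
      (hR.trans (Nat.mul_le_mul_right e (by omega))))
    simp only [Finset.mem_filter, Finset.mem_univ, true_and] at hx ⊢
    obtain ⟨hx, y, hy, rfl⟩ := hx
    rw [hRf x hx, ← hγ x hx, add_sub_cancel_left, hfv y hy, mul_zero]
  by_cases h : ∃ c₀, ∀ y, E.eval y ≠ 0 → f (c₀ - γ y) = 0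
  · obtain ⟨c₀, hc₀⟩ := h
    exact ⟨c₀, fun c hc => hbound c fun hc' => hc (huniq _ _ hc' hc₀)⟩
  · exact ⟨0, fun c _ => hbound c fun hc => h ⟨c, hc⟩⟩

end Periodic

section Counting

/-- Counting five-term representations when two-term sums are well distributed outside a single
exceptional value. -/
lemma card_five_term_le {α G : Type*} [DecidableEq α] [AddCommGroup G] [DecidableEq G]
    (S : Finset α) (γ : α → G) {k e : ℕ} {c₀ : G}
    (hfib : ∀ g, (S.filter fun x => γ x = g).card ≤ e)
    (hsum : ∀ c, c ≠ c₀ → (S.filter fun x => ∃ y ∈ S, γ x + γ y = c).card ≤ k) (c : G) :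
    ((Fintype.piFinset fun _ : Fin 5 => S).filter fun y =>
      -γ (y 0) - γ (y 1) - γ (y 2) + γ (y 3) - γ (y 4) = c).card ≤
      (k * e + e * e) * S.card ^ 3 := by
  set T := (Fintype.piFinset fun _ : Fin 5 => S).filter fun y =>
      -γ (y 0) - γ (y 1) - γ (y 2) + γ (y 3) - γ (y 4) = c with hT
  have memT : ∀ {y}, y ∈ T → (∀ i, y i ∈ S) ∧
      -γ (y 0) - γ (y 1) - γ (y 2) + γ (y 3) - γ (y 4) = c := by
    intro y hy
    simpa [hT] using hy
  have hcube : (S ×ˢ S ×ˢ S).card = S.card ^ 3 := by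
    simp only [Finset.card_product]
    ring
  rw [← Finset.card_filter_add_card_filter_not (s := T) (fun y => γ (y 0) + γ (y 1) = c₀),
    add_comm, add_mul, ← hcube]
  refine add_le_add ?_ ?_
  · refine Finset.card_le_mul_card_image_of_maps_to (f := fun y => (y 2, y 3, y 4))
      (fun y hy => ?_) _ ?_
    · have := (memT (Finset.mem_filter.1 hy).1).1
      simp [this]
    · rintro ⟨s, t, u⟩ -
      rw [mul_comm k e]
      by_cases hc : c₀ = -c - γ s + γ t - γ u
      · refine (Finset.card_eq_zero.2 (Finset.filter_eq_empty_iff.2 fun y hy => ?_)).trans_le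
          (Nat.zero_le _)
        simp only [Finset.mem_filter, Prod.mk.injEq] at hy ⊢
        rintro ⟨rfl, rfl, rfl⟩
        refine hy.2 ?_
        rw [hc, ← (memT hy.1).2]
        abel
      · refine le_trans (Finset.card_le_mul_card_image_of_maps_to (f := fun y => y 0)
          (t := S.filter fun x => ∃ y ∈ S, γ x + γ y = -c - γ s + γ t - γ u)
          (fun y hy => ?_) e ?_) (Nat.mul_le_mul_left e (hsum _ (Ne.symm hc)))
        · simp only [Finset.mem_filter, Prod.mk.injEq] at hy ⊢
          obtain ⟨⟨hy, -⟩, rfl, rfl, rfl⟩ := hy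
          refine ⟨(memT hy).1 0, y 1, (memT hy).1 1, ?_⟩
          rw [← (memT hy).2]
          abel
        · intro x _
          refine le_trans (Finset.card_le_card_of_injOn (fun y => y 1) (fun y hy => ?_) ?_)
            (hfib (-c - γ s + γ t - γ u - γ x))
          · simp only [Finset.coe_filter, Finset.mem_filter, Prod.mk.injEq,
              Set.mem_ofPred_eq] at hy ⊢
            obtain ⟨⟨⟨hy, -⟩, rfl, rfl, rfl⟩, rfl⟩ := hy
            refine ⟨(memT hy).1 1, ?_⟩
            rw [← (memT hy).2]
            abel
          · intro y hy z hz hyz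
            simp only [Finset.coe_filter, Finset.mem_filter, Prod.mk.injEq,
              Set.mem_ofPred_eq] at hy hz hyz
            funext i
            fin_cases i <;> simp_all
  · refine Finset.card_le_mul_card_image_of_maps_to (f := fun y => (y 0, y 2, y 3))
      (fun y hy => ?_) _ ?_
    · have := (memT (Finset.mem_filter.1 hy).1).1
      simp [this]
    · rintro ⟨x, s, t⟩ -
      refine le_trans (Finset.card_le_card_of_injOn
        (t := (S.filter fun z => γ z = c₀ - γ x) ×ˢ
          (S.filter fun z => γ z = -c - c₀ - γ s + γ t)) (fun y => (y 1, y 4))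
        (fun y hy => ?_) ?_) ?_
      · simp only [Finset.coe_filter, Finset.mem_filter, Prod.mk.injEq, Finset.coe_product,
          Set.mem_prod, Set.mem_ofPred_eq] at hy ⊢
        obtain ⟨⟨hy, rfl⟩, rfl, rfl, rfl⟩ := hy
        refine ⟨⟨(memT hy).1 1, by abel⟩, (memT hy).1 4, ?_⟩
        rw [← (memT hy).2]
        abel
      · intro y hy z hz hyz
        simp only [Finset.coe_filter, Finset.mem_filter, Prod.mk.injEq,
          Set.mem_ofPred_eq] at hy hz hyz
        funext i
        fin_cases i <;> simp_all
      · rw [Finset.card_product]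
        exact Nat.mul_le_mul (hfib _) (hfib _)

end Counting

section Reduction

/-- Linear independence of integer polynomials over `ℚ` persists modulo all but finitely many
primes. -/
lemma exists_linearIndependent_mod {ι : Type*} [Fintype ι] (v : ι → ℤ[X])
    (hv : LinearIndependent ℚ fun i => (v i).map (Int.castRingHom ℚ)) :
    ∃ N : ℤ, N ≠ 0 ∧ ∀ (p : ℕ) [Fact p.Prime], (N : ZMod p) ≠ 0 →
      LinearIndependent (ZMod p) fun i => (v i).map (Int.castRingHom (ZMod p)) := by
  classical
  obtain ⟨g, hg⟩ := LinearMap.exists_leftInverse_of_injective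
    (Finsupp.linearCombination ℚ fun i => (v i).map (Int.castRingHom ℚ))
    (LinearMap.ker_eq_bot.2 hv)
  let s := Finset.univ.biUnion fun i => (v i).support
  obtain ⟨⟨N, hN⟩, hNr⟩ := IsLocalization.exist_integer_multiples_of_finset (nonZeroDivisors ℤ)
    ((Finset.univ ×ˢ s).image fun x : ι × ℕ => g (X ^ x.2) x.1)
  have hz : ∀ j, ∀ k ∈ s, ∃ z : ℤ, (z : ℚ) = N * g (X ^ k) j := by
    intro j k hk
    obtain ⟨z, hz⟩ := hNr (g (X ^ k) j)
      (Finset.mem_image_of_mem (fun x : ι × ℕ => g (X ^ x.2) x.1) (a := (j, k)) (by simp [hk]))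
    exact ⟨z, by simpa [Submonoid.smul_def] using hz⟩
  choose! z hz using hz
  have hexp : ∀ i j, ∑ k ∈ s, (v i).coeff k * z j k = if i = j then N else 0 := by
    intro i j
    have h1 := congrArg (fun φ => φ j) (LinearMap.congr_fun hg (Finsupp.single i 1))
    have h2 : (v i).map (Int.castRingHom ℚ) = ∑ k ∈ s, ((v i).coeff k : ℚ) • X ^ k := by
      conv_lhs => rw [(v i).as_sum_support]
      rw [Polynomial.map_sum]
      refine Finset.sum_subset_zero_on_sdiff (Finset.subset_biUnion_of_mem
        (fun i => (v i).support) (Finset.mem_univ i)) (fun k hk => ?_) fun k _ => ?_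
      · have : (v i).coeff k = 0 := by simpa using (Finset.mem_sdiff.1 hk).2
        simp [this]
      · simp [← C_mul_X_pow_eq_monomial, smul_eq_C_mul]
    simp only [LinearMap.comp_apply, Finsupp.linearCombination_single, one_smul,
      LinearMap.id_apply, h2, map_sum, map_smul, Finsupp.coe_finsetSum, Finset.sum_apply,
      Finsupp.smul_apply, smul_eq_mul, Finsupp.single_apply] at h1
    have h3 : ((∑ k ∈ s, (v i).coeff k * z j k : ℤ) : ℚ) = ((if i = j then N else 0 : ℤ) : ℚ) := by
      push_cast
      rw [← mul_boole, ← h1, Finset.mul_sum]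
      refine Finset.sum_congr rfl fun k hk => ?_
      rw [hz j k hk]
      ring
    exact_mod_cast h3
  refine ⟨N, nonZeroDivisors.ne_zero hN, fun p _ hp => Fintype.linearIndependent_iff.2 ?_⟩
  intro α hα j
  have hcoeff : ∀ k, ∑ i, α i * ((v i).coeff k : ZMod p) = 0 := by
    intro k
    simpa [finsetSum_coeff] using congrArg (fun f => coeff f k) hα
  have hmod : ∀ i, ∑ k ∈ s, ((v i).coeff k : ZMod p) * z j k = if i = j then (N : ZMod p) else 0 := by
    intro i
    have := congrArg (Int.cast : ℤ → ZMod p) (hexp i j)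
    push_cast at this
    exact this
  have : ∑ k ∈ s, (∑ i, α i * ((v i).coeff k : ZMod p)) * z j k = α j * N := by
    simp only [Finset.sum_mul]
    rw [Finset.sum_comm]
    simp only [mul_assoc, ← Finset.mul_sum, hmod, mul_ite, mul_zero, Finset.sum_ite_eq',
      Finset.mem_univ, if_true]
  simp only [hcoeff, zero_mul, Finset.sum_const_zero] at this
  exact (mul_eq_zero.1 this.symm).resolve_right hp

lemma exists_integer_model (f : ℚ[X]) :
    ∃ (N : ℤ) (g : ℤ[X]), N ≠ 0 ∧ g.map (Int.castRingHom ℚ) = (N : ℚ) • f := by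
  obtain ⟨N, hN, h⟩ := IsLocalization.integerNormalization_spec (nonZeroDivisors ℤ) f
  refine ⟨N, IsLocalization.integerNormalization (nonZeroDivisors ℤ) f,
    nonZeroDivisors.ne_zero hN, h.trans ?_⟩
  ext i
  simp

lemma intCast_mul_ratRed {p : ℕ} [Fact p.Prime] {N z : ℤ} {q : ℚ} (h : (z : ℚ) = N * q)
    (hN : (N : ZMod p) ≠ 0) (hN0 : N ≠ 0) : (N : ZMod p) * ratRed p q = z := by
  have hq : q = (z : ℚ) / (N : ℤ) := by
    rw [h, mul_div_cancel_left₀ _ (by exact_mod_cast hN0)]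
  have hcross : z * q.den = q.num * N := by
    have := Rat.num_div_den q
    have hd : (q.den : ℚ) ≠ 0 := by exact_mod_cast q.den_ne_zero
    have h' : (z : ℚ) * q.den = q.num * N := by
      rw [h]
      nth_rewrite 1 [← this]
      field_simp
    exact_mod_cast h'
  have hden : (q.den : ZMod p) ≠ 0 := by
    intro h0
    have hdvd : (q.den : ℤ) ∣ N := by
      rw [hq, ← Rat.divInt_eq_div]
      exact Rat.den_dvd z N
    obtain ⟨k, hk⟩ := hdvd
    exact hN (by rw [hk]; simp [h0])
  have hmod := congrArg (Int.cast : ℤ → ZMod p) hcross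
  push_cast at hmod
  rw [ratRed, ← mul_assoc, mul_inv_eq_iff_eq_mul₀ hden, hmod, mul_comm]

lemma map_eq_smul_polyRed {p : ℕ} [Fact p.Prime] {N : ℤ} {f : ℚ[X]} {g : ℤ[X]}
    (h : g.map (Int.castRingHom ℚ) = (N : ℚ) • f) (hN : (N : ZMod p) ≠ 0) (hN0 : N ≠ 0) :
    g.map (Int.castRingHom (ZMod p)) = (N : ZMod p) • polyRed p f := by
  ext n
  have hred : (polyRed p f).coeff n = ratRed p (f.coeff n) := by
    simp only [polyRed, Polynomial.sum_def, finsetSum_coeff, coeff_C_mul, coeff_X_pow,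
      mul_ite, mul_one, mul_zero, Finset.sum_ite_eq, mem_support_iff]
    split_ifs with h0
    · rfl
    · simp [ratRed, not_not.1 h0]
  have hn := congrArg (fun f => coeff f n) h
  simp only [coeff_map, coeff_smul, smul_eq_mul, eq_intCast] at hn ⊢
  rw [hred, intCast_mul_ratRed hn hN hN0]

/-- A common integral model of two rational functions, up to a nonzero factor `N`. -/
lemma exists_integer_models (P Q : RatFunc ℚ) :
    ∃ (N : ℤ) (P₁ P₂ Q₁ Q₂ : ℤ[X]), N ≠ 0 ∧
      P₁.map (Int.castRingHom ℚ) = (N : ℚ) • P.num ∧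
      P₂.map (Int.castRingHom ℚ) = (N : ℚ) • P.denom ∧
      Q₁.map (Int.castRingHom ℚ) = (N : ℚ) • Q.num ∧
      Q₂.map (Int.castRingHom ℚ) = (N : ℚ) • Q.denom := by
  obtain ⟨N₁, f₁, h₁, e₁⟩ := exists_integer_model P.num
  obtain ⟨N₂, f₂, h₂, e₂⟩ := exists_integer_model P.denom
  obtain ⟨N₃, f₃, h₃, e₃⟩ := exists_integer_model Q.num
  obtain ⟨N₄, f₄, h₄, e₄⟩ := exists_integer_model Q.denom
  refine ⟨N₁ * N₂ * N₃ * N₄, C (N₂ * N₃ * N₄) * f₁, C (N₁ * N₃ * N₄) * f₂,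
    C (N₁ * N₂ * N₄) * f₃, C (N₁ * N₂ * N₃) * f₄, by positivity, ?_, ?_, ?_, ?_⟩ <;>
  · simp only [Polynomial.map_mul, map_C, e₁, e₂, e₃, e₄, smul_eq_C_mul, ← mul_assoc, ← C_mul]
    congr 2
    simp only [eq_intCast]
    push_cast
    ring

lemma linearIndependent_common_denominator {P Q : RatFunc ℚ}
    (hPQ : LinearIndependent ℚ ![P, Q, (1 : RatFunc ℚ)]) {N : ℤ} {P₁ P₂ Q₁ Q₂ : ℤ[X]}
    (hN : N ≠ 0) (hP₁ : P₁.map (Int.castRingHom ℚ) = (N : ℚ) • P.num)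
    (hP₂ : P₂.map (Int.castRingHom ℚ) = (N : ℚ) • P.denom)
    (hQ₁ : Q₁.map (Int.castRingHom ℚ) = (N : ℚ) • Q.num)
    (hQ₂ : Q₂.map (Int.castRingHom ℚ) = (N : ℚ) • Q.denom) :
    LinearIndependent ℚ fun i =>
      (![P₁ * Q₂, Q₁ * P₂, P₂ * Q₂] i).map (Int.castRingHom ℚ) := by
  refine Fintype.linearIndependent_iff.2 fun α hα => Fintype.linearIndependent_iff.1 hPQ α ?_
  have hN' : (N : ℚ) ≠ 0 := by exact_mod_cast hN
  have hPd : algebraMap ℚ[X] (RatFunc ℚ) P.denom ≠ 0 :=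
    RatFunc.algebraMap_ne_zero P.denom_ne_zero
  have hQd : algebraMap ℚ[X] (RatFunc ℚ) Q.denom ≠ 0 :=
    RatFunc.algebraMap_ne_zero Q.denom_ne_zero
  have hα' : α 0 • (P.num * Q.denom) + α 1 • (Q.num * P.denom) + α 2 • (P.denom * Q.denom) = 0 := by
    simp only [Fin.sum_univ_three, Matrix.cons_val_zero, Matrix.cons_val_one, Matrix.cons_val,
      Polynomial.map_mul, hP₁, hP₂, hQ₁, hQ₂] at hα
    have : ((N : ℚ) * N) • (α 0 • (P.num * Q.denom) + α 1 • (Q.num * P.denom) +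
        α 2 • (P.denom * Q.denom)) = 0 := by
      rw [← hα]
      simp only [smul_eq_C_mul, C_mul]
      ring
    exact (smul_eq_zero.1 this).resolve_left (mul_ne_zero hN' hN')
  have h := congrArg (algebraMap ℚ[X] (RatFunc ℚ)) hα'
  simp only [map_add, map_mul, map_zero, smul_eq_C_mul] at h
  have hC : ∀ q : ℚ, algebraMap ℚ (RatFunc ℚ) q = algebraMap ℚ[X] (RatFunc ℚ) (C q) :=
    RingHom.congr_fun (RingHom.ext_rat _ ((algebraMap ℚ[X] (RatFunc ℚ)).comp C))
  have eP := (div_eq_iff hPd).1 (RatFunc.num_div_denom P)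
  have eQ := (div_eq_iff hQd).1 (RatFunc.num_div_denom Q)
  rw [← mul_right_inj' (mul_ne_zero hPd hQd), mul_zero, ← h]
  simp only [Fin.sum_univ_three, Matrix.cons_val_zero, Matrix.cons_val_one, Matrix.cons_val,
    Algebra.smul_def, hC, eP, eQ]
  ring

lemma evalRed_eq_div {p : ℕ} [Fact p.Prime] {P : RatFunc ℚ} {N : ℤ} {P₁ P₂ : ℤ[X]}
    (hN : (N : ZMod p) ≠ 0) (hN0 : N ≠ 0)
    (hP₁ : P₁.map (Int.castRingHom ℚ) = (N : ℚ) • P.num)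
    (hP₂ : P₂.map (Int.castRingHom ℚ) = (N : ℚ) • P.denom) (y : ZMod p) :
    evalRed p P y = (P₁.map (Int.castRingHom (ZMod p))).eval y /
      (P₂.map (Int.castRingHom (ZMod p))).eval y := by
  rw [map_eq_smul_polyRed hP₁ hN hN0, map_eq_smul_polyRed hP₂ hN hN0, eval_smul, eval_smul,
    smul_eq_mul, smul_eq_mul, mul_div_mul_left _ _ hN, evalRed, div_eq_mul_inv]

lemma isPole_iff {p : ℕ} [Fact p.Prime] {P : RatFunc ℚ} {N : ℤ} {P₂ : ℤ[X]}
    (hN : (N : ZMod p) ≠ 0) (hN0 : N ≠ 0)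
    (hP₂ : P₂.map (Int.castRingHom ℚ) = (N : ℚ) • P.denom) (y : ZMod p) :
    IsPole p P y ↔ (P₂.map (Int.castRingHom (ZMod p))).eval y = 0 := by
  rw [map_eq_smul_polyRed hP₂ hN hN0, eval_smul, smul_eq_mul, mul_eq_zero, or_iff_right hN, IsPole]

lemma intCast_zmod_ne_zero_of_natAbs_lt_s11 {p : ℕ} {N : ℤ} (hN : N ≠ 0) (h : N.natAbs < p) :
    (N : ZMod p) ≠ 0 := by
  rw [Ne, ZMod.intCast_zmod_eq_zero_iff_dvd, Int.natCast_dvd]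
  exact fun hd => absurd (Nat.le_of_dvd (Int.natAbs_pos.2 hN) hd) (not_le.2 h)

/-- The five-term count for a curve with an explicit common denominator. -/
lemma card_five_term_curve_le {p : ℕ} [Fact p.Prime] {A B E : (ZMod p)[X]}
    (hind : LinearIndependent (ZMod p) ![A, B, E]) {e : ℕ} (he : 1 ≤ e) (hA : A.natDegree ≤ e)
    (hB : B.natDegree ≤ e) (hE : E.natDegree ≤ e) (hp : (4 * e + 1) * e < p)
    {γ : ZMod p → ZMod p × ZMod p}
    (hγ : ∀ y, E.eval y ≠ 0 → γ y = (A.eval y / E.eval y, B.eval y / E.eval y))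
    (c : ZMod p × ZMod p) :
    Nat.card {y : Fin 5 → ZMod p // (∀ i, E.eval (y i) ≠ 0) ∧
      -γ (y 0) - γ (y 1) - γ (y 2) + γ (y 3) - γ (y 4) = c} ≤
      (4 * e * e * e + e * e) * p ^ 3 := by
  obtain ⟨c₀, hc₀⟩ := exists_exceptional_sum hind he hA hB hE hp hγ
  have hfib : ∀ g, ((Finset.univ.filter fun y => E.eval y ≠ 0).filter
      fun y => γ y = g).card ≤ e := by
    intro g
    refine (Finset.card_le_card fun y hy => ?_).trans
      (card_filter_linear_eq_le hind hA hB hE (α := 1) (β := 0) (Or.inl one_ne_zero) g.1)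
    simp only [Finset.mem_filter, Finset.mem_univ, true_and] at hy ⊢
    refine ⟨hy.1, ?_⟩
    rw [← hy.2, hγ y hy.1]
    ring
  set S := Finset.univ.filter fun y => E.eval y ≠ 0 with hS
  have hcard : S.card ≤ p := (Finset.card_le_univ _).trans_eq (ZMod.card p)
  have hfive := card_five_term_le S γ hfib (fun c hc => by convert hc₀ c hc) c
  refine le_trans (le_of_eq ?_)
    (hfive.trans (Nat.mul_le_mul_left _ (Nat.pow_le_pow_left hcard 3)))
  refine Nat.subtype_card _ fun y => ?_
  simp only [hS, Finset.mem_filter, Fintype.mem_piFinset, Finset.mem_univ, true_and]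

end Reduction

/-- **Step 4 of Theorem 4.2.** Uniform point count `|X_{a,b}(F_p)| ≪ p³` for the auxiliary
varieties `X_{a,b}` in the five variables `(y₂,y₃,y₅,y₇,y₈)`. -/
theorem Xab_count (P Q : RatFunc ℚ)
    (hPQ : LinearIndependent ℚ ![P, Q, (1 : RatFunc ℚ)]) :
    ∃ C : ℝ, 0 < C ∧ ∀ (p : ℕ) [Fact p.Prime],
      Admissible p P → Admissible p Q →
      ∀ a b : ZMod p,
        (Nat.card {y : Fin 5 → ZMod p //
            (∀ i, ¬ IsPole p P (y i)) ∧ (∀ i, ¬ IsPole p Q (y i)) ∧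
            -evalRed p P (y 0) - evalRed p P (y 1) - evalRed p P (y 2) +
                evalRed p P (y 3) - evalRed p P (y 4) = a ∧
            -evalRed p Q (y 0) - evalRed p Q (y 1) - evalRed p Q (y 2) +
                evalRed p Q (y 3) - evalRed p Q (y 4) = b} : ℝ) ≤
          C * (p : ℝ) ^ 3 := by
  obtain ⟨N, P₁, P₂, Q₁, Q₂, hN0, hP₁, hP₂, hQ₁, hQ₂⟩ := exists_integer_models P Q
  obtain ⟨M, hM0, hM⟩ := exists_linearIndependent_mod _
    (linearIndependent_common_denominator hPQ hN0 hP₁ hP₂ hQ₁ hQ₂)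
  let e := (P₁ * Q₂).natDegree + (Q₁ * P₂).natDegree + (P₂ * Q₂).natDegree + 1
  let B := N.natAbs + M.natAbs + (4 * e + 1) * e
  refine ⟨((B ^ 2 + (4 * e * e * e + e * e) : ℕ) : ℝ), by positivity, ?_⟩
  intro p _ _ _ a b
  norm_cast
  rcases le_or_gt p B with hpB | hpB
  · refine (Nat.card_le_card_of_injective _ Subtype.val_injective).trans ?_
    rw [Nat.card_eq_fintype_card, Fintype.card_fun, ZMod.card, Fintype.card_fin]
    calc p ^ 5 = p ^ 2 * p ^ 3 := by ring
      _ ≤ _ := Nat.mul_le_mul_right _ ((Nat.pow_le_pow_left hpB 2).trans (Nat.le_add_right _ _))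
  · have hN : (N : ZMod p) ≠ 0 := intCast_zmod_ne_zero_of_natAbs_lt_s11 hN0 (by omega)
    have hind : LinearIndependent (ZMod p) ![(P₁ * Q₂).map (Int.castRingHom (ZMod p)),
        (Q₁ * P₂).map (Int.castRingHom (ZMod p)), (P₂ * Q₂).map (Int.castRingHom (ZMod p))] := by
      convert hM p (intCast_zmod_ne_zero_of_natAbs_lt_s11 hM0 (by omega)) using 1
      funext i
      fin_cases i <;> rfl
    have hcount := card_five_term_curve_le hind (e := e) (by omega)
      (natDegree_map_le.trans (by omega)) (natDegree_map_le.trans (by omega))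
      (natDegree_map_le.trans (by omega)) (by omega)
      (γ := fun y => (evalRed p P y, evalRed p Q y)) (fun y hy => ?_) (a, b)
    · refine le_trans (le_of_eq ?_) (hcount.trans (Nat.mul_le_mul_right _ (Nat.le_add_left _ _)))
      refine Nat.card_congr (Equiv.subtypeEquivRight fun y => ?_)
      simp only [isPole_iff hN hN0 hP₂, isPole_iff hN hN0 hQ₂, Polynomial.map_mul, eval_mul,
        mul_ne_zero_iff, forall_and, Prod.ext_iff, Prod.fst_add, Prod.snd_add, Prod.fst_sub,
        Prod.snd_sub, Prod.fst_neg, Prod.snd_neg, and_assoc, ne_eq]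
    · rw [Polynomial.map_mul, eval_mul, mul_ne_zero_iff] at hy
      simp only [evalRed_eq_div hN hN0 hP₁ hP₂, evalRed_eq_div hN hN0 hQ₁ hQ₂,
        Polynomial.map_mul, eval_mul]
      rw [mul_div_mul_right _ _ hy.2, mul_comm (eval y (P₂.map _)), mul_div_mul_right _ _ hy.1]

end RatCorners
end
end
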